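/- arXiv:2311.15885 — 2 statements merged into one kernel-verified Lean document; each statement's English description precedes it below -/
import Mathlib

section
/- For every integer k ≥ 3 there exist a real ε > 0 and a natural number n₀ such that for every n > n₀ there are a finite relational signature σ, all of whose relation symbols have arity at most k, and two σ-structures 𝒜, ℬ with |A| = |B| = n, such that some sentence of L^k distinguishes 𝒜 from ℬ, yet 𝒜 and ℬ agree on every sentence φ of L^k with quant(φ) < 2^{εn}. -/
namespace QVT

/-- A finite relational signature: a finite type of relation symbols, each with an arity. -/
structure Signature : Type 1 where
  symbols : Type
  fin : Fintype symbols
  arity : symbols → ℕ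

/-- A structure over a relational signature. -/
structure Struct (σ : Signature) : Type 1 where
  carrier : Type
  rel : (R : σ.symbols) → (Fin (σ.arity R) → carrier) → Prop

/-- First-order formulas over the signature `σ`, with variables indexed by `ℕ`
(variable `i` represents `x_{i+1}`; variables may be reused and requantified). -/
inductive Fml (σ : Signature) : Type
  | eq : ℕ → ℕ → Fml σ
  | rel : (R : σ.symbols) → (Fin (σ.arity R) → ℕ) → Fml σ
  | not : Fml σ → Fml σ
  | and : Fml σ → Fml σ → Fml σ
  | or : Fml σ → Fml σ → Fml σ
  | ex : ℕ → Fml σ → Fml σ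
  | all : ℕ → Fml σ → Fml σ

namespace Fml

variable {σ : Signature}

/-- Satisfaction of a formula in a structure under a (total) variable assignment. -/
def Sat (M : Struct σ) : (ℕ → M.carrier) → Fml σ → Prop
  | f, .eq i j => f i = f j
  | f, .rel R v => M.rel R fun m => f (v m)
  | f, .not φ => ¬ Sat M f φ
  | f, .and φ ψ => Sat M f φ ∧ Sat M f ψ
  | f, .or φ ψ => Sat M f φ ∨ Sat M f ψ
  | f, .ex i φ => ∃ a : M.carrier, Sat M (Function.update f i a) φ
  | f, .all i φ => ∀ a : M.carrier, Sat M (Function.update f i a) φ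

/-- All variables (free or bound) occurring in a formula. -/
def vars : Fml σ → Finset ℕ
  | .eq i j => {i, j}
  | .rel _ v => Finset.univ.image v
  | .not φ => vars φ
  | .and φ ψ => vars φ ∪ vars ψ
  | .or φ ψ => vars φ ∪ vars ψ
  | .ex i φ => insert i (vars φ)
  | .all i φ => insert i (vars φ)

/-- The free variables of a formula. -/
def freeVars : Fml σ → Finset ℕ
  | .eq i j => {i, j}
  | .rel _ v => Finset.univ.image v
  | .not φ => freeVars φ
  | .and φ ψ => freeVars φ ∪ freeVars ψ
  | .or φ ψ => freeVars φ ∪ freeVars ψ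
  | .ex i φ => (freeVars φ).erase i
  | .all i φ => (freeVars φ).erase i

/-- The number of quantifier occurrences in a formula. -/
def quant : Fml σ → ℕ
  | .eq _ _ => 0
  | .rel _ _ => 0
  | .not φ => quant φ
  | .and φ ψ => quant φ + quant ψ
  | .or φ ψ => quant φ + quant ψ
  | .ex _ φ => quant φ + 1
  | .all _ φ => quant φ + 1

/-- The quantifier depth (quantifier rank) of a formula. -/
def depth : Fml σ → ℕ
  | .eq _ _ => 0
  | .rel _ _ => 0
  | .not φ => depth φ
  | .and φ ψ => max (depth φ) (depth ψ)
  | .or φ ψ => max (depth φ) (depth ψ)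
  | .ex _ φ => depth φ + 1
  | .all _ φ => depth φ + 1

/-- The size (total number of symbols) of a formula. -/
def size : Fml σ → ℕ
  | .eq _ _ => 3
  | .rel R _ => 1 + σ.arity R
  | .not φ => size φ + 1
  | .and φ ψ => size φ + size ψ + 1
  | .or φ ψ => size φ + size ψ + 1
  | .ex _ φ => size φ + 2
  | .all _ φ => size φ + 2

/-- The existential-positive formulas: built from atomic formulas using only
`∧`, `∨` and `∃`. -/
def ExPos : Fml σ → Prop
  | .eq _ _ => True
  | .rel _ _ => True
  | .not _ => False
  | .and φ ψ => ExPos φ ∧ ExPos ψ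
  | .or φ ψ => ExPos φ ∧ ExPos ψ
  | .ex _ φ => ExPos φ
  | .all _ _ => False

end Fml

/-- `φ` is a formula of `L^k`: it only uses the variables `x_1, …, x_k`
(indices `0, …, k-1`). -/
def UsesVars {σ : Signature} (k : ℕ) (φ : Fml σ) : Prop :=
  ∀ i ∈ φ.vars, i < k

/-- A sentence is a formula with no free variables. -/
def IsSentence {σ : Signature} (φ : Fml σ) : Prop := φ.freeVars = ∅

/-- Satisfaction of a sentence (assignment-independent for sentences over
nonempty structures). -/
def SatS {σ : Signature} (M : Struct σ) (φ : Fml σ) : Prop :=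
  ∀ f : ℕ → M.carrier, Fml.Sat M f φ

/-- `φ` distinguishes `A` from `B`: `A ⊨ φ` and `B ⊭ φ`. -/
def Distinguishes {σ : Signature} (A B : Struct σ) (φ : Fml σ) : Prop :=
  SatS A φ ∧ ¬ SatS B φ

/-- `A` and `B` agree on `φ`. -/
def AgreeOn {σ : Signature} (A B : Struct σ) (φ : Fml σ) : Prop :=
  SatS A φ ↔ SatS B φ

/-- A pebbled structure: a structure together with a partial assignment of the
variables to elements. -/
structure Pebbled (σ : Signature) : Type 1 where
  M : Struct σ
  α : ℕ → Option M.carrier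

/-- The domain of the partial assignment of a pebbled structure. -/
def Pebbled.dom {σ : Signature} (P : Pebbled σ) : Set ℕ := {i | P.α i ≠ none}

/-- A `k`-pebbled structure: only the variables `x_1, …, x_k` may be assigned. -/
def Pebbled.IsK {σ : Signature} (k : ℕ) (P : Pebbled σ) : Prop :=
  ∀ i, k ≤ i → P.α i = none

/-- Satisfaction for pebbled structures: `φ` holds under every total extension of
the partial assignment. -/
def PSat {σ : Signature} (P : Pebbled σ) (φ : Fml σ) : Prop :=
  ∀ f : ℕ → P.M.carrier, (∀ i a, P.α i = some a → f i = a) → Fml.Sat P.M f φ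

/-- Two sets of pebbled structures disagree on `φ`: every member of `𝔄`
satisfies `φ` and no member of `𝔅` does. -/
def DisagreeOn {σ : Signature} (𝔄 𝔅 : Set (Pebbled σ)) (φ : Fml σ) : Prop :=
  (∀ P ∈ 𝔄, PSat P φ) ∧ (∀ P ∈ 𝔅, ¬ PSat P φ)

/-! ## Combinatorics of sites and hyperedges -/

/-- Hyperedges: `(false, i)` is an interval, `(true, i)` is an interval with a gap. -/
def eset (K : ℕ) : Bool × ℕ → Finset ℕ
  | (false, i) => Finset.Ico i (i + K)
  | (true, i) => (Finset.Ico i (i + K + 1)).erase (i + K - 1)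

def Win (K i : ℕ) : Finset ℕ := Finset.Ico i (i + K + 1)

def Win2 (K i : ℕ) : Finset ℕ := insert i (eset K (true, i + 1))

def cost : Bool × ℕ → ℕ
  | (false, i) => Nat.fib i
  | (true, i) => Nat.fib (i - 1)

abbrev Lam (K : ℕ) := Bool × Fin (K + 1)

def lab (K : ℕ) (e : Bool × ℕ) : Lam K := (e.1, Fin.ofNat (K + 1) e.2)

theorem mem_esetI {K i s : ℕ} : s ∈ eset K (false, i) ↔ i ≤ s ∧ s < i + K := by
  simp [eset]

theorem mem_esetJ {K i s : ℕ} :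
    s ∈ eset K (true, i) ↔ i ≤ s ∧ s < i + K + 1 ∧ s ≠ i + K - 1 := by
  simp only [eset, Finset.mem_erase, Finset.mem_Ico]
  tauto

theorem mem_Win {K i s : ℕ} : s ∈ Win K i ↔ i ≤ s ∧ s < i + K + 1 := by
  simp [Win]

theorem mem_Win2 {K i s : ℕ} (hK : 2 ≤ K) :
    s ∈ Win2 K i ↔ i ≤ s ∧ s < i + K + 2 ∧ s ≠ i + K := by
  simp only [Win2, Finset.mem_insert, mem_esetJ]
  omega

theorem card_eset {K : ℕ} (hK : 2 ≤ K) (e : Bool × ℕ) : (eset K e).card = K := by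
  obtain ⟨b, i⟩ := e
  cases b
  · simp [eset]
  · simp only [eset]
    rw [Finset.card_erase_of_mem (by simp; omega)]
    simp; omega

theorem card_Win {K i : ℕ} : (Win K i).card = K + 1 := by
  rw [Win, Nat.card_Ico, add_assoc, Nat.add_sub_cancel_left]

theorem card_Win2 {K i : ℕ} (hK : 2 ≤ K) : (Win2 K i).card = K + 1 := by
  rw [Win2, Finset.card_insert_of_notMem, card_eset hK]
  rw [mem_esetJ]; omega

theorem eset_bound {K s : ℕ} {e : Bool × ℕ} (h : s ∈ eset K e) : e.2 ≤ s ∧ s < e.2 + K + 1 := by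
  obtain ⟨b, i⟩ := e
  cases b
  · rw [mem_esetI] at h; simp; omega
  · rw [mem_esetJ] at h; simp; omega

theorem lab_inj {K s : ℕ} {e e' : Bool × ℕ} (h : s ∈ eset K e) (h' : s ∈ eset K e')
    (hl : lab K e = lab K e') : e = e' := by
  have b1 := eset_bound h
  have b2 := eset_bound h'
  obtain ⟨b, i⟩ := e
  obtain ⟨b', i'⟩ := e'
  simp only [lab, Prod.mk.injEq] at hl b1 b2 ⊢
  refine ⟨hl.1, ?_⟩
  have h3 : i % (K + 1) = i' % (K + 1) := by
    have := congrArg Fin.val hl.2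
    simpa [Fin.ofNat] using this
  rcases le_total i i' with hle | hle
  · have h4 := (Nat.modEq_iff_dvd' hle).1 h3
    have := Nat.eq_zero_of_dvd_of_lt h4 (by omega)
    omega
  · have h4 := (Nat.modEq_iff_dvd' hle).1 h3.symm
    have := Nat.eq_zero_of_dvd_of_lt h4 (by omega)
    omega

theorem sub_Win {K i : ℕ} (hK : 2 ≤ K) {e : Bool × ℕ} (h : eset K e ⊆ Win K i) :
    e = (false, i + 1) ∨ e = (false, i) ∨ e = (true, i) := by
  obtain ⟨b, j⟩ := e
  cases b
  · have h1 := h (mem_esetI.2 (⟨le_refl j, by omega⟩ : j ≤ j ∧ j < j + K))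
    have h2 := h (mem_esetI.2 (⟨by omega, by omega⟩ : j ≤ j + K - 1 ∧ j + K - 1 < j + K))
    rw [mem_Win] at h1 h2
    simp; omega
  · have h1 := h (mem_esetJ.2 (⟨le_refl j, by omega, by omega⟩ :
      j ≤ j ∧ j < j + K + 1 ∧ j ≠ j + K - 1))
    have h2 := h (mem_esetJ.2 (⟨by omega, by omega, by omega⟩ :
      j ≤ j + K ∧ j + K < j + K + 1 ∧ j + K ≠ j + K - 1))
    rw [mem_Win] at h1 h2
    simp; omega

theorem sub_Win2 {K i : ℕ} (hK : 2 ≤ K) {e : Bool × ℕ} (h : eset K e ⊆ Win2 K i) :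
    e = (true, i + 1) ∨ e = (false, i) := by
  obtain ⟨b, j⟩ := e
  cases b
  · have h1 := h (mem_esetI.2 (⟨le_refl j, by omega⟩ : j ≤ j ∧ j < j + K))
    have h2 := h (mem_esetI.2 (⟨by omega, by omega⟩ : j ≤ j + K - 1 ∧ j + K - 1 < j + K))
    have h3 := fun hh => h (mem_esetI.2 (hh : j ≤ i + K ∧ i + K < j + K))
    rw [(mem_Win2 hK)] at h1 h2 h3
    simp; omega
  · have h1 := h (mem_esetJ.2 (⟨le_refl j, by omega, by omega⟩ :
      j ≤ j ∧ j < j + K + 1 ∧ j ≠ j + K - 1))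
    have h2 := h (mem_esetJ.2 (⟨by omega, by omega, by omega⟩ :
      j ≤ j + K ∧ j + K < j + K + 1 ∧ j + K ≠ j + K - 1))
    rw [(mem_Win2 hK)] at h1 h2
    simp
    by_contra hne
    omega

theorem Win_inj {K i j : ℕ} (h : Win K i ⊆ Win K j) : i = j := by
  have h1 := h (mem_Win.2 (⟨le_refl i, by omega⟩ : i ≤ i ∧ i < i + K + 1))
  have h2 := h (mem_Win.2 (⟨by omega, by omega⟩ : i ≤ i + K ∧ i + K < i + K + 1))
  rw [mem_Win] at h1 h2
  omega

theorem Win2_inj {K i j : ℕ} (hK : 2 ≤ K) (h : Win2 K i ⊆ Win2 K j) : i = j := by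
  have h1 := h ((mem_Win2 hK).2 (⟨le_refl i, by omega, by omega⟩ : i ≤ i ∧ i < i + K + 2 ∧ i ≠ i + K))
  have h2 := h ((mem_Win2 hK).2 (⟨by omega, by omega, by omega⟩ :
    i ≤ i + K + 1 ∧ i + K + 1 < i + K + 2 ∧ i + K + 1 ≠ i + K))
  rw [(mem_Win2 hK)] at h1 h2
  omega

theorem not_Win2_sub_Win {K i j : ℕ} (hK : 2 ≤ K) (h : Win2 K i ⊆ Win K j) : False := by
  have h1 := h ((mem_Win2 hK).2 (⟨le_refl i, by omega, by omega⟩ : i ≤ i ∧ i < i + K + 2 ∧ i ≠ i + K))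
  have h2 := h ((mem_Win2 hK).2 (⟨by omega, by omega, by omega⟩ :
    i ≤ i + K + 1 ∧ i + K + 1 < i + K + 2 ∧ i + K + 1 ≠ i + K))
  rw [mem_Win] at h1 h2
  omega

theorem not_Win_sub_Win2 {K i j : ℕ} (hK : 2 ≤ K) (h : Win K i ⊆ Win2 K j) : False := by
  have := Finset.eq_of_subset_of_card_le h (by rw [card_Win, card_Win2 hK])
  exact not_Win2_sub_Win hK this.ge

theorem I1_sub_Win {K i : ℕ} : eset K (false, i + 1) ⊆ Win K i := by
  intro s; rw [mem_esetI, mem_Win]; omega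

theorem I_sub_Win {K i : ℕ} : eset K (false, i) ⊆ Win K i := by
  intro s; rw [mem_esetI, mem_Win]; omega

theorem J_sub_Win {K i : ℕ} : eset K (true, i) ⊆ Win K i := by
  intro s; rw [mem_esetJ, mem_Win]; omega

theorem J_sub_Win2 {K i : ℕ} : eset K (true, i + 1) ⊆ Win2 K i :=
  Finset.subset_insert _ _

theorem I_sub_Win2 {K i : ℕ} (hK : 2 ≤ K) : eset K (false, i) ⊆ Win2 K i := by
  intro s; rw [mem_esetI, (mem_Win2 hK)]; omega

/-! ## Hyperedge values -/

abbrev Dl (K : ℕ) := ℕ → Lam K → ZMod 2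

def wt {K : ℕ} (δ : Dl K) (e : Bool × ℕ) : ZMod 2 := ∑ s ∈ eset K e, δ s (lab K e)

theorem wt_congr {K : ℕ} {δ δ' : Dl K} {e : Bool × ℕ} (h : ∀ s ∈ eset K e, δ s = δ' s) :
    wt δ e = wt δ' e := by
  apply Finset.sum_congr rfl
  intro s hs; rw [h s hs]

theorem realize {K : ℕ} (δ : Dl K) (z : ℕ) (h : Bool × ℕ → ZMod 2) :
    ∃ δ' : Dl K, (∀ s, s ≠ z → δ' s = δ s) ∧
      ∀ e, wt δ' e = if z ∈ eset K e then h e else wt δ e := by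
  classical
  let v : Lam K → ZMod 2 := fun l =>
    if hh : ∃ e, z ∈ eset K e ∧ lab K e = l then
      h hh.choose - ∑ s ∈ (eset K hh.choose).erase z, δ s l else 0
  have hv : ∀ e, z ∈ eset K e → v (lab K e) = h e - ∑ s ∈ (eset K e).erase z, δ s (lab K e) := by
    intro e he
    have hh : ∃ e', z ∈ eset K e' ∧ lab K e' = lab K e := ⟨e, he, rfl⟩
    have hc : hh.choose = e := lab_inj hh.choose_spec.1 he hh.choose_spec.2
    simp only [v, dif_pos hh, hc]
  refine ⟨Function.update δ z v, fun s hs => Function.update_of_ne hs _ _, fun e => ?_⟩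
  split_ifs with he
  · rw [wt, ← Finset.add_sum_erase _ _ he, Function.update_self, hv e he]
    have hsum : ∑ x ∈ (eset K e).erase z, Function.update δ z v x (lab K e) =
        ∑ x ∈ (eset K e).erase z, δ x (lab K e) := by
      apply Finset.sum_congr rfl
      intro s hs
      rw [Function.update_of_ne (Finset.ne_of_mem_erase hs)]
    rw [hsum]; ring
  · apply wt_congr
    intro s hs
    rw [Function.update_of_ne]
    rintro rfl; exact he hs

/-- Validity of a position: `S` is the set of pebbled sites. -/
structure Valid (K N : ℕ) (S : Finset ℕ) (δ : Dl K) (c : ℕ) : Prop where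
  v1 : ∀ e, eset K e ⊆ S → wt δ e = 1 → c ≤ cost e
  v2 : eset K (false, N) ⊆ S → wt δ (false, N) = 1
  v3 : ∀ i, i < N → Win K i ⊆ S → wt δ (false, i + 1) = wt δ (false, i) + wt δ (true, i)
  v4 : ∀ i, i + 1 < N → Win2 K i ⊆ S → wt δ (true, i + 1) = wt δ (false, i)

theorem Valid.mono {K N : ℕ} {S : Finset ℕ} {δ : Dl K} {c : ℕ} (h : Valid K N S δ c)
    {S' : Finset ℕ} (hS : S' ⊆ S) {c' : ℕ} (hc : c' ≤ c) : Valid K N S' δ c' :=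
  ⟨fun e he h1 => hc.trans (h.v1 e (he.trans hS) h1), fun he => h.v2 (he.trans hS),
    fun i hi hw => h.v3 i hi (hw.trans hS), fun i hi hw => h.v4 i hi (hw.trans hS)⟩

theorem Valid.of_card {K N : ℕ} (hK : 2 ≤ K) {S : Finset ℕ} {δ : Dl K} {c : ℕ}
    (hS : S.card ≤ K)
    (v1 : ∀ e, eset K e ⊆ S → wt δ e = 1 → c ≤ cost e)
    (v2 : eset K (false, N) ⊆ S → wt δ (false, N) = 1) : Valid K N S δ c := by
  refine ⟨v1, v2, fun i _ hw => ?_, fun i _ hw => ?_⟩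
  · have := Finset.card_le_card hw
    rw [card_Win] at this; omega
  · have := Finset.card_le_card hw
    rw [card_Win2 hK] at this; omega

theorem zmod2_ne_one {x : ZMod 2} (h : x ≠ 1) : x = 0 := by
  revert x; decide

theorem zmod2_cases (x : ZMod 2) : x = 0 ∨ x = 1 := by
  revert x; decide

theorem cost_nonneg_fib {N c : ℕ} (hc : c ≤ Nat.fib (N - 2)) {i : ℕ} (hi : N - 2 ≤ i) :
    c ≤ Nat.fib i := hc.trans (Nat.fib_mono hi)
theorem reply {K N : ℕ} (hK : 2 ≤ K) {S : Finset ℕ} {δ : Dl K} {c : ℕ}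
    (hS : S.card ≤ K) (hv : Valid K N S δ c) (hc : c ≤ Nat.fib (N - 2)) (z : ℕ) :
    (∃ δ' : Dl K, (∀ s ∈ S, δ' s = δ s) ∧ Valid K N (insert z S) δ' c) ∨
    (∃ i, i < N ∧ S = eset K (false, i + 1) ∧ z = i ∧ wt δ (false, i + 1) = 1) := by
  by_cases hz : z ∈ S
  · left
    refine ⟨δ, fun _ _ => rfl, ?_⟩
    rwa [Finset.insert_eq_of_mem hz]
  -- a general way to conclude
  have key : ∀ h : Bool × ℕ → ZMod 2,
      (∀ e, z ∈ eset K e → eset K e ⊆ insert z S → h e = 1 → c ≤ cost e) →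
      (z ∈ eset K (false, N) → eset K (false, N) ⊆ insert z S → h (false, N) = 1) →
      (∀ i, i < N → Win K i = insert z S →
        (if z ∈ eset K (false, i + 1) then h (false, i + 1) else wt δ (false, i + 1)) =
        (if z ∈ eset K (false, i) then h (false, i) else wt δ (false, i)) +
        (if z ∈ eset K (true, i) then h (true, i) else wt δ (true, i))) →
      (∀ i, i + 1 < N → Win2 K i = insert z S →
        (if z ∈ eset K (true, i + 1) then h (true, i + 1) else wt δ (true, i + 1)) =
        (if z ∈ eset K (false, i) then h (false, i) else wt δ (false, i))) →
      (∃ δ' : Dl K, (∀ s ∈ S, δ' s = δ s) ∧ Valid K N (insert z S) δ' c) := by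
    intro h h1 h2 h3 h4
    obtain ⟨δ', hd, hw⟩ := realize δ z h
    have hcard : (insert z S).card ≤ K + 1 := (Finset.card_insert_le _ _).trans (by omega)
    have hsub : ∀ e, z ∉ eset K e → eset K e ⊆ insert z S → eset K e ⊆ S := by
      intro e he hes
      exact (Finset.subset_insert_iff_of_notMem he).1 hes
    refine ⟨δ', fun s hs => hd s (by rintro rfl; exact hz hs), ?_, ?_, ?_, ?_⟩
    · intro e he
      rw [hw]
      split_ifs with hze
      · exact h1 e hze he
      · exact hv.v1 e (hsub e hze he)
    · intro he
      rw [hw]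
      split_ifs with hze
      · exact h2 hze he
      · exact hv.v2 (hsub _ hze he)
    · intro i hi hwi
      rw [hw, hw, hw]
      exact h3 i hi (Finset.eq_of_subset_of_card_le hwi (by rw [card_Win]; exact hcard))
    · intro i hi hwi
      rw [hw, hw]
      exact h4 i hi (Finset.eq_of_subset_of_card_le hwi (by rw [card_Win2 hK]; exact hcard))
  -- windows
  have hWsub : ∀ (T : Finset ℕ), T = insert z S → ∀ e, eset K e ⊆ T → z ∉ eset K e →
      eset K e ⊆ S := by
    rintro T rfl e he hze
    exact (Finset.subset_insert_iff_of_notMem hze).1 he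
  by_cases hW : ∃ i, i < N ∧ Win K i = insert z S
  · obtain ⟨i, hi, hWi⟩ := hW
    have uniq : ∀ j, Win K j = insert z S → j = i := fun j hj => Win_inj (hj.trans hWi.symm).le
    have no2 : ∀ j, Win2 K j ≠ insert z S := fun j hj =>
      not_Win2_sub_Win hK (hj.trans hWi.symm).le
    have hzW : i ≤ z ∧ z < i + K + 1 := by
      have : z ∈ Win K i := by rw [hWi]; exact Finset.mem_insert_self _ _
      rwa [mem_Win] at this
    -- reduce to choosing three values
    have key2 : ∀ p q r : ZMod 2, p = q + r → (z ∉ eset K (false, i + 1) → p = wt δ (false, i + 1)) →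
        (z ∉ eset K (false, i) → q = wt δ (false, i)) →
        (z ∉ eset K (true, i) → r = wt δ (true, i)) →
        (p = 1 → c ≤ Nat.fib (i + 1)) → (q = 1 → c ≤ Nat.fib i) → (r = 1 → c ≤ Nat.fib (i - 1)) →
        (i + 1 = N → p = 1) →
        (∃ δ' : Dl K, (∀ s ∈ S, δ' s = δ s) ∧ Valid K N (insert z S) δ' c) := by
      intro p q r hpqr hp hq hr cp cq cr hN
      apply key (fun e => if e = (false, i + 1) then p else if e = (false, i) then q else r)
      · intro e hze he
        rw [← hWi] at he
        rcases sub_Win hK he with rfl | rfl | rfl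
        · simpa [cost] using cp
        · simpa [cost] using cq
        · simpa [cost] using cr
      · intro _ he
        rw [← hWi] at he
        rcases sub_Win hK he with h | h | h
        · simp only [h, if_true]
          apply hN; simp at h; omega
        · simp at h; omega
        · simp at h
      · intro j _ hj
        obtain rfl := uniq j hj
        have e1 : (if z ∈ eset K (false, j + 1) then p else wt δ (false, j + 1)) = p := by
          split_ifs with hh
          · rfl
          · exact (hp hh).symm
        have e2 : (if z ∈ eset K (false, j) then q else wt δ (false, j)) = q := by
          split_ifs with hh
          · rfl
          · exact (hq hh).symm
        have e3 : (if z ∈ eset K (true, j) then r else wt δ (true, j)) = r := by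
          split_ifs with hh
          · rfl
          · exact (hr hh).symm
        simp
        rw [e1, e2, e3]; exact hpqr
      · intro j _ hj
        exact absurd hj (no2 j)
    by_cases hzi : z = i
    · have hnz : z ∉ eset K (false, i + 1) := by rw [mem_esetI]; omega
      have hsub := hWsub _ hWi _ I1_sub_Win hnz
      by_cases hw1 : wt δ (false, i + 1) = 1
      · right
        refine ⟨i, hi, ?_, hzi, hw1⟩
        exact (Finset.eq_of_subset_of_card_le hsub (by rw [card_eset hK]; exact hS)).symm
      · left
        apply key2 0 0 0 (by ring) (fun _ => (zmod2_ne_one hw1).symm)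
        · intro h; rw [mem_esetI] at h; omega
        · intro h; rw [mem_esetJ] at h; omega
        · simp
        · simp
        · simp
        · rintro rfl; exact absurd (hv.v2 hsub) hw1
    left
    have hp : z ∈ eset K (false, i + 1) := by rw [mem_esetI]; omega
    by_cases hzk : z = i + K
    · have hnz : z ∉ eset K (false, i) := by rw [mem_esetI]; omega
      have hsub := hWsub _ hWi _ I_sub_Win hnz
      have hr : z ∈ eset K (true, i) := by rw [mem_esetJ]; omega
      by_cases hiN : i + 1 = N
      · apply key2 1 (wt δ (false, i)) (1 + wt δ (false, i)) _ (fun h => absurd hp h) (fun _ => rfl)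
          (fun h => absurd hr h)
        · intro _; exact cost_nonneg_fib hc (by omega)
        · intro h; exact hv.v1 _ hsub h
        · intro _; exact cost_nonneg_fib hc (by omega)
        · intro _; rfl
        · rcases zmod2_cases (wt δ (false, i)) with h | h <;> rw [h] <;> decide
      · apply key2 (wt δ (false, i)) (wt δ (false, i)) 0 (by ring) (fun h => absurd hp h) (fun _ => rfl)
          (fun h => absurd hr h)
        · intro h; exact (hv.v1 _ hsub h).trans (Nat.fib_mono (by omega))
        · intro h; exact hv.v1 _ hsub h
        · simp
        · intro h; exact absurd h hiN
    have hq : z ∈ eset K (false, i) := by rw [mem_esetI]; omega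
    by_cases hzj : z ∈ eset K (true, i)
    · by_cases hiN : i + 1 = N
      · apply key2 1 1 0 (by ring) (fun h => absurd hp h) (fun h => absurd hq h)
          (fun h => absurd hzj h)
        · intro _; exact cost_nonneg_fib hc (by omega)
        · intro _; exact cost_nonneg_fib hc (by omega)
        · simp
        · intro _; rfl
      · apply key2 0 0 0 (by ring) (fun h => absurd hp h) (fun h => absurd hq h)
          (fun h => absurd hzj h) (by simp) (by simp) (by simp) (fun h => absurd h hiN)
    · have hsub := hWsub _ hWi _ J_sub_Win hzj
      by_cases hiN : i + 1 = N
      · apply key2 1 (1 + wt δ (true, i)) (wt δ (true, i)) _ (fun h => absurd hp h)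
          (fun h => absurd hq h) (fun _ => rfl)
        · intro _; exact cost_nonneg_fib hc (by omega)
        · intro _; exact cost_nonneg_fib hc (by omega)
        · intro h; exact hv.v1 _ hsub h
        · intro _; rfl
        · rcases zmod2_cases (wt δ (true, i)) with h | h <;> rw [h] <;> decide
      · apply key2 (wt δ (true, i)) 0 (wt δ (true, i)) (by ring) (fun h => absurd hp h)
          (fun h => absurd hq h) (fun _ => rfl)
        · intro h
          have : c ≤ Nat.fib (i - 1) := hv.v1 _ hsub h
          exact this.trans (Nat.fib_mono (by omega))
        · simp
        · intro h; exact hv.v1 _ hsub h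
        · intro h; exact absurd h hiN
  left
  by_cases hW2 : ∃ i, i + 1 < N ∧ Win2 K i = insert z S
  · obtain ⟨i, hi, hWi⟩ := hW2
    have uniq : ∀ j, Win2 K j = insert z S → j = i :=
      fun j hj => Win2_inj hK (hj.trans hWi.symm).le
    have key2 : ∀ p : ZMod 2, (z ∉ eset K (true, i + 1) → p = wt δ (true, i + 1)) →
        (z ∉ eset K (false, i) → p = wt δ (false, i)) →
        (p = 1 → c ≤ Nat.fib i) →
        (∃ δ' : Dl K, (∀ s ∈ S, δ' s = δ s) ∧ Valid K N (insert z S) δ' c) := by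
      intro p hp hq cp
      apply key (fun _ => p)
      · intro e hze he
        rw [← hWi] at he
        rcases sub_Win2 hK he with rfl | rfl
        · simpa [cost] using cp
        · simpa [cost] using cp
      · intro _ he
        rw [← hWi] at he
        rcases sub_Win2 hK he with h | h
        · simp at h
        · simp at h; omega
      · intro j hj hj2
        exact absurd ⟨j, hj, hj2⟩ hW
      · intro j _ hj
        obtain rfl := uniq j hj
        have e1 : (if z ∈ eset K (true, j + 1) then p else wt δ (true, j + 1)) = p := by
          split_ifs with hh
          · rfl
          · exact (hp hh).symm
        have e2 : (if z ∈ eset K (false, j) then p else wt δ (false, j)) = p := by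
          split_ifs with hh
          · rfl
          · exact (hq hh).symm
        rw [e1, e2]
    by_cases h1 : z ∈ eset K (true, i + 1)
    · by_cases h2 : z ∈ eset K (false, i)
      · exact key2 0 (fun h => absurd h1 h) (fun h => absurd h2 h) (by simp)
      · exact key2 (wt δ (false, i)) (fun h => absurd h1 h) (fun _ => rfl)
          (fun h => hv.v1 _ (hWsub _ hWi _ (I_sub_Win2 hK) h2) h)
    · refine key2 (wt δ (true, i + 1)) (fun _ => rfl) (fun h => ?_)
          (fun h => hv.v1 _ (hWsub _ hWi _ J_sub_Win2 h1) h)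
      exfalso
      have hz' : z ∈ Win2 K i := by rw [hWi]; exact Finset.mem_insert_self _ _
      rw [(mem_Win2 hK)] at hz'
      rw [mem_esetJ] at h1
      rw [mem_esetI] at h
      omega
  · apply key (fun e => if e = (false, N) then 1 else 0)
    · intro e _ _ h
      by_cases he : e = (false, N)
      · subst he; exact cost_nonneg_fib hc (by omega)
      · simp [he] at h
    · simp
    · intro j hj hj2
      exact absurd ⟨j, hj, hj2⟩ hW
    · intro j hj hj2
      exact absurd ⟨j, hj, hj2⟩ hW2
/-! ## The structures -/

abbrev Car (K M r : ℕ) := (Fin M × (Lam K → ZMod 2)) ⊕ Fin r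

def site {K M r : ℕ} : Car K M r → ℕ
  | .inl p => p.1
  | .inr j => M + j

def bits {K M r : ℕ} : Car K M r → Lam K → ZMod 2
  | .inl p => p.2
  | .inr _ => 0

def sh {K M r : ℕ} (δ : Dl K) : Car K M r → Car K M r
  | .inl p => .inl (p.1, p.2 + δ p.1)
  | .inr j => .inr j

theorem sh_sh {K M r : ℕ} (δ : Dl K) (a : Car K M r) : sh δ (sh δ a) = a := by
  rcases a with ⟨s, v⟩ | j
  · simp only [sh]
    congr 2
    rw [add_assoc]
    have : δ s + δ s = 0 := by
      funext l; exact CharTwo.add_self_eq_zero _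
    rw [this, add_zero]
  · rfl

theorem site_sh {K M r : ℕ} (δ : Dl K) (a : Car K M r) : site (sh δ a) = site a := by
  rcases a with ⟨s, v⟩ | j <;> rfl

theorem sh_congr {K M r : ℕ} {δ δ' : Dl K} {a : Car K M r} (h : δ (site a) = δ' (site a)) :
    sh δ a = sh δ' a := by
  rcases a with ⟨s, v⟩ | j
  · simp only [sh, site] at h ⊢
    rw [h]
  · rfl

theorem bits_sh {K M r : ℕ} (δ : Dl K) (a : Car K M r) (h : site a < M) :
    bits (sh δ a) = bits a + δ (site a) := by
  rcases a with ⟨s, v⟩ | j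
  · rfl
  · simp [site] at h

/-- Value of a hyperedge on a tuple. -/
def tw {K M r : ℕ} (t : Fin (K + 1) → Car K M r) (e : Bool × ℕ) : ZMod 2 :=
  ∑ m ∈ Finset.univ.filter (fun m => site (t m) ∈ eset K e), bits (t m) (lab K e)

def tS {K M r : ℕ} (t : Fin (K + 1) → Car K M r) : Finset ℕ :=
  Finset.univ.image (fun m => site (t m))

structure RelOK (N : ℕ) (τ : ZMod 2) {K M r : ℕ} (t : Fin (K + 1) → Car K M r) : Prop where
  r1 : ∀ i, i < N → tS t = Win K i → tw t (false, i + 1) = tw t (false, i) + tw t (true, i)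
  r2 : ∀ i, i + 1 < N → tS t = Win2 K i → tw t (true, i + 1) = tw t (false, i)
  r3 : 0 < N → tS t = Win K 0 → tw t (false, 0) = 0 ∧ tw t (true, 0) = 0
  r4 : ∀ i, i + 1 = N → tS t = Win K i → tw t (false, N) = τ

def sig (K L : ℕ) : Signature where
  symbols := Option (Fin L)
  fin := inferInstance
  arity := fun R => match R with
    | none => K + 1
    | some _ => 1

def Str (K M r N : ℕ) (τ : ZMod 2) : Struct (sig K (M + r)) where
  carrier := Car K M r
  rel := fun R => match R with
    | none => fun (t : Fin (K + 1) → Car K M r) => RelOK N τ t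
    | some s => fun (t : Fin 1 → Car K M r) => site (t 0) = s.val

theorem tw_sh {K M r : ℕ} {t : Fin (K + 1) → Car K M r} (δ : Dl K) {e : Bool × ℕ}
    (hc : (tS t).card = K + 1) (hM : ∀ s ∈ tS t, s < M) (he : eset K e ⊆ tS t) :
    tw (fun m => sh δ (t m)) e = tw t e + wt δ e := by
  have hinj : Function.Injective (fun m => site (t m)) := by
    have h0 : Set.InjOn (fun m => site (t m)) ((Finset.univ : Finset (Fin (K + 1))) : Set _) := by
      apply Finset.card_image_iff.1
      simpa [tS] using hc
    simpa [Set.injOn_univ] using h0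
  have h1 : wt δ e = ∑ m ∈ Finset.univ.filter (fun m => site (t m) ∈ eset K e),
      δ (site (t m)) (lab K e) := by
    rw [wt]
    symm
    apply Finset.sum_bij (fun m _ => site (t m))
    · intro m hm; simpa using hm
    · intro a _ b _ h; exact hinj h
    · intro s hs
      have := he hs
      simp only [tS, Finset.mem_image, Finset.mem_univ, true_and] at this
      obtain ⟨m, rfl⟩ := this
      exact ⟨m, by simpa using hs, rfl⟩
    · intro m _; rfl
  rw [h1, tw, tw, ← Finset.sum_add_distrib]
  simp only [site_sh]
  apply Finset.sum_congr rfl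
  intro m _
  rw [bits_sh δ _ (hM _ (Finset.mem_image_of_mem _ (Finset.mem_univ m)))]
  rfl

theorem tS_sh {K M r : ℕ} (t : Fin (K + 1) → Car K M r) (δ : Dl K) :
    tS (fun m => sh δ (t m)) = tS t := by
  simp [tS, site_sh]

theorem relOK_sh {K M r N : ℕ} (hK : 2 ≤ K) (hM : N + K ≤ M) {t : Fin (K + 1) → Car K M r}
    {δ : Dl K} {c : ℕ} (hc : 1 ≤ c) (hv : Valid K N (tS t) δ c) :
    RelOK N 0 t ↔ RelOK N 1 (fun m => sh δ (t m)) := by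
  have hw : ∀ i, i < N → tS t = Win K i → ∀ e, eset K e ⊆ tS t →
      tw (fun m => sh δ (t m)) e = tw t e + wt δ e := by
    intro i hi ht e he
    apply tw_sh δ _ _ he
    · rw [ht, card_Win]
    · intro s hs
      rw [ht, mem_Win] at hs; omega
  have hw2 : ∀ i, i + 1 < N → tS t = Win2 K i → ∀ e, eset K e ⊆ tS t →
      tw (fun m => sh δ (t m)) e = tw t e + wt δ e := by
    intro i hi ht e he
    apply tw_sh δ _ _ he
    · rw [ht, card_Win2 hK]
    · intro s hs
      rw [ht, (mem_Win2 hK)] at hs; omega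
  have a1 : ∀ i, i < N → tS t = Win K i →
      ((tw (fun m => sh δ (t m)) (false, i + 1) =
      tw (fun m => sh δ (t m)) (false, i) + tw (fun m => sh δ (t m)) (true, i)) ↔
      (tw t (false, i + 1) = tw t (false, i) + tw t (true, i))) := by
    intro i hi ht
    rw [hw i hi ht _ (ht ▸ I1_sub_Win), hw i hi ht _ (ht ▸ I_sub_Win), hw i hi ht _ (ht ▸ J_sub_Win),
      hv.v3 i hi ht.ge]
    constructor
    · intro h; linear_combination h
    · intro h; linear_combination h
  have a2 : ∀ i, i + 1 < N → tS t = Win2 K i →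
      ((tw (fun m => sh δ (t m)) (true, i + 1) = tw (fun m => sh δ (t m)) (false, i)) ↔
      (tw t (true, i + 1) = tw t (false, i))) := by
    intro i hi ht
    rw [hw2 i hi ht _ (ht ▸ J_sub_Win2), hw2 i hi ht _ (ht ▸ (I_sub_Win2 hK)), hv.v4 i hi ht.ge]
    constructor
    · intro h; linear_combination h
    · intro h; linear_combination h
  have a3 : 0 < N → tS t = Win K 0 → (tw (fun m => sh δ (t m)) (false, 0) = tw t (false, 0) ∧
      tw (fun m => sh δ (t m)) (true, 0) = tw t (true, 0)) := by
    intro hN ht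
    have z1 : wt δ (false, 0) = 0 := by
      apply zmod2_ne_one
      intro h
      have := hv.v1 _ (ht ▸ I_sub_Win) h
      simp [cost] at this; omega
    have z2 : wt δ (true, 0) = 0 := by
      apply zmod2_ne_one
      intro h
      have := hv.v1 _ (ht ▸ J_sub_Win) h
      simp [cost] at this; omega
    rw [hw 0 hN ht _ (ht ▸ I_sub_Win), hw 0 hN ht _ (ht ▸ J_sub_Win), z1, z2]
    simp
  have a4 : ∀ i, i + 1 = N → tS t = Win K i →
      tw (fun m => sh δ (t m)) (false, N) = tw t (false, N) + 1 := by
    intro i hi ht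
    have hs : eset K (false, N) ⊆ tS t := by rw [ht, ← hi]; exact I1_sub_Win
    rw [hw i (by omega) ht _ hs, hv.v2 hs]
  constructor
  · rintro ⟨r1, r2, r3, r4⟩
    refine ⟨?_, ?_, ?_, ?_⟩
    · intro i hi ht
      rw [tS_sh] at ht
      exact (a1 i hi ht).2 (r1 i hi ht)
    · intro i hi ht
      rw [tS_sh] at ht
      exact (a2 i hi ht).2 (r2 i hi ht)
    · intro hN ht
      rw [tS_sh] at ht
      rw [(a3 hN ht).1, (a3 hN ht).2]; exact r3 hN ht
    · intro i hi ht
      rw [tS_sh] at ht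
      rw [a4 i hi ht, r4 i hi ht, zero_add]
  · rintro ⟨r1, r2, r3, r4⟩
    rw [tS_sh] at r1 r2 r3 r4
    refine ⟨?_, ?_, ?_, ?_⟩
    · intro i hi ht
      exact (a1 i hi ht).1 (r1 i hi ht)
    · intro i hi ht
      exact (a2 i hi ht).1 (r2 i hi ht)
    · intro hN ht
      have := r3 hN ht
      rwa [(a3 hN ht).1, (a3 hN ht).2] at this
    · intro i hi ht
      have := r4 i hi ht
      rw [a4 i hi ht] at this
      linear_combination this

/-! ## Lower bound -/

/-- Sites pebbled by the variables below `K + 1` other than `x`. -/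
def offS {K M r : ℕ} (f : ℕ → Car K M r) (x : ℕ) : Finset ℕ :=
  ((Finset.range (K + 1)).erase x).image (fun p => site (f p))

def allS {K M r : ℕ} (f : ℕ → Car K M r) : Finset ℕ :=
  (Finset.range (K + 1)).image (fun p => site (f p))

theorem offS_sub {K M r : ℕ} (f : ℕ → Car K M r) (x : ℕ) : offS f x ⊆ allS f :=
  Finset.image_subset_image (Finset.erase_subset _ _)

theorem card_offS {K M r : ℕ} (f : ℕ → Car K M r) {x : ℕ} (hx : x < K + 1) :
    (offS f x).card ≤ K := by
  refine Finset.card_image_le.trans ?_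
  rw [Finset.card_erase_of_mem (Finset.mem_range.2 hx)]
  simp

theorem allS_update {K M r : ℕ} (f : ℕ → Car K M r) {x : ℕ} (hx : x < K + 1) (a : Car K M r) :
    allS (Function.update f x a) = insert (site a) (offS f x) := by
  rw [allS, offS, ← Finset.insert_erase (Finset.mem_range.2 hx), Finset.image_insert,
    Finset.erase_insert_eq_erase, Finset.erase_idem]
  simp only [Function.update_self]
  congr 1
  apply Finset.image_congr
  intro p hp
  have : p ≠ x := by
    have := Finset.mem_coe.1 hp
    exact Finset.ne_of_mem_erase this
  simp [Function.update_of_ne this]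

def Pos {K M r : ℕ} (f g : ℕ → Car K M r) (δ : Dl K) : Prop :=
  ∀ p, p < K + 1 → g p = sh δ (f p)

def PosOff {K M r : ℕ} (x : ℕ) (f g : ℕ → Car K M r) (δ : Dl K) : Prop :=
  ∀ p, p < K + 1 → p ≠ x → g p = sh δ (f p)

def Sep {K M r : ℕ} (N : ℕ) (φ : Fml (sig K (M + r))) (f g : ℕ → Car K M r) : Prop :=
  ¬ (Fml.Sat (Str K M r N 0) f φ ↔ Fml.Sat (Str K M r N 1) g φ)

theorem pos_update {K M r : ℕ} {x : ℕ} {f g : ℕ → Car K M r} {δ δ' : Dl K}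
    (h : PosOff x f g δ) (hd : ∀ s ∈ offS f x, δ' s = δ s) {a b : Car K M r}
    (hb : b = sh δ' a) : Pos (Function.update f x a) (Function.update g x b) δ' := by
  intro p hp
  by_cases hpx : p = x
  · subst hpx; simp [hb]
  · rw [Function.update_of_ne hpx, Function.update_of_ne hpx, h p hp hpx]
    apply sh_congr
    rw [hd]
    apply Finset.mem_image_of_mem
    simp [hpx, hp]

/-- The single-position claim. -/
def P1 {K M r : ℕ} (N : ℕ) (φ : Fml (sig K (M + r))) : Prop :=
  ∀ (c : ℕ) (f g : ℕ → Car K M r) (δ : Dl K), c ≤ Nat.fib (N - 2) → Pos f g δ →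
    Valid K N (allS f) δ c → Sep N φ f g → c ≤ φ.quant

/-- The claim for pairs of positions. -/
def P2 {K M r : ℕ} (N : ℕ) (φ : Fml (sig K (M + r))) : Prop :=
  ∀ (c i : ℕ) (f0 g0 f1 g1 : ℕ → Car K M r) (δ0 δ1 : Dl K), c ≤ Nat.fib (N - 2) →
    c ≤ Nat.fib (i + 1) → 1 ≤ i → i < N → Pos f0 g0 δ0 → Pos f1 g1 δ1 →
    (∀ p, p < K + 1 → site (f0 p) = site (f1 p)) → allS f0 = Win K i →
    wt δ0 (false, i + 1) = 1 → wt δ0 (false, i) = 1 → wt δ0 (true, i) = 0 →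
    wt δ1 (false, i + 1) = 1 → wt δ1 (false, i) = 0 → wt δ1 (true, i) = 1 →
    Sep N φ f0 g0 → Sep N φ f1 g1 → c ≤ φ.quant

theorem valid_Win {K N i c : ℕ} (hK : 2 ≤ K) {δ : Dl K} (hp : wt δ (false, i + 1) = 1)
    (hpqr : wt δ (false, i + 1) = wt δ (false, i) + wt δ (true, i)) (hiN : i < N)
    (c1 : c ≤ Nat.fib (i + 1)) (c2 : wt δ (false, i) = 1 → c ≤ Nat.fib i)
    (c3 : wt δ (true, i) = 1 → c ≤ Nat.fib (i - 1)) : Valid K N (Win K i) δ c := by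
  refine ⟨?_, ?_, ?_, ?_⟩
  · intro e he h
    rcases sub_Win hK he with rfl | rfl | rfl
    · exact c1
    · exact c2 h
    · exact c3 h
  · intro he
    rcases sub_Win hK he with h | h | h
    · rwa [h]
    · simp at h; omega
    · simp at h
  · intro j _ hj
    obtain rfl := Win_inj hj
    exact hpqr
  · intro j _ hj
    exact (not_Win2_sub_Win hK hj).elim

/-- The quantifier step. -/
theorem quant_step {K M r N : ℕ} (hK : 2 ≤ K) {ψ : Fml (sig K (M + r))} (h1 : P1 N ψ) (h2 : P2 N ψ)
    {x : ℕ} (hx : x < K + 1) {c : ℕ} {f g : ℕ → Car K M r} {δ : Dl K} (hc : c ≤ Nat.fib (N - 2))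
    (hpos : PosOff x f g δ) (hv : Valid K N (offS f x) δ c)
    (hs : (∃ a, ∀ b, Sep N ψ (Function.update f x a) (Function.update g x b)) ∨
      (∃ b, ∀ a, Sep N ψ (Function.update f x a) (Function.update g x b))) :
    c ≤ ψ.quant + 1 := by
  obtain ⟨z, hz⟩ : ∃ z, ∀ δ' : Dl K, ∃ a b, site a = z ∧ b = sh δ' a ∧
      Sep N ψ (Function.update f x a) (Function.update g x b) := by
    rcases hs with ⟨a, ha⟩ | ⟨b, hb⟩
    · exact ⟨site a, fun δ' => ⟨a, sh δ' a, rfl, rfl, ha _⟩⟩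
    · exact ⟨site b, fun δ' => ⟨sh δ' b, b, site_sh _ _, (sh_sh _ _).symm, hb _⟩⟩
  rcases reply hK (card_offS f hx) hv hc z with ⟨δ', hd, hv'⟩ | ⟨i, hi, hS, rfl, hw⟩
  · obtain ⟨a, b, rfl, hb, hsep⟩ := hz δ'
    have := h1 c _ _ δ' hc (pos_update hpos hd hb) (by rw [allS_update f hx]; exact hv') hsep
    omega
  · have hci : c ≤ Nat.fib (z + 1) := hv.v1 (false, z + 1) hS.ge hw
    rcases Nat.eq_zero_or_pos z with rfl | hzpos
    · simp at hci; omega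
    have hnz : z ∉ eset K (false, z + 1) := by rw [mem_esetI]; omega
    have hzI : z ∈ eset K (false, z) := by rw [mem_esetI]; omega
    have hzJ : z ∈ eset K (true, z) := by rw [mem_esetJ]; omega
    have hzS : z ∉ offS f x := hS ▸ hnz
    obtain ⟨δ0, hd0, hw0⟩ := realize δ z (fun e => if e = (false, z) then 1 else 0)
    obtain ⟨δ1, hd1, hw1⟩ := realize δ z (fun e => if e = (true, z) then 1 else 0)
    obtain ⟨a0, b0, ha0, hb0, hsep0⟩ := hz δ0
    obtain ⟨a1, b1, ha1, hb1, hsep1⟩ := hz δ1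
    have hd0' : ∀ s ∈ offS f x, δ0 s = δ s := fun s hs => hd0 s (by rintro rfl; exact hzS hs)
    have hd1' : ∀ s ∈ offS f x, δ1 s = δ s := fun s hs => hd1 s (by rintro rfl; exact hzS hs)
    have := h2 c z _ _ _ _ δ0 δ1 hc hci hzpos hi (pos_update hpos hd0' hb0)
      (pos_update hpos hd1' hb1) ?_ ?_ ?_ ?_ ?_ ?_ ?_ ?_ hsep0 hsep1
    · omega
    · intro p _
      by_cases hpx : p = x
      · subst hpx; simp [ha0, ha1]
      · simp [Function.update_of_ne hpx]
    · rw [allS_update f hx, hS, ha0]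
      ext s
      rw [Finset.mem_insert, mem_esetI, mem_Win]; omega
    · rw [hw0, if_neg hnz, hw]
    · rw [hw0, if_pos hzI]; simp
    · rw [hw0, if_pos hzJ]; simp
    · rw [hw1, if_neg hnz, hw]
    · rw [hw1, if_pos hzI]; simp
    · rw [hw1, if_pos hzJ]; simp

/-- From a pair of positions, every variable is bad for one of them. -/
theorem pair_off {K M r N : ℕ} (hK : 2 ≤ K) {c i : ℕ} {f0 f1 : ℕ → Car K M r} {δ0 δ1 : Dl K}
    (hci : c ≤ Nat.fib (i + 1)) (hiN : i < N)
    (hsite : ∀ p, p < K + 1 → site (f0 p) = site (f1 p)) (hW : allS f0 = Win K i)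
    (p0 : wt δ0 (false, i + 1) = 1) (r0 : wt δ0 (true, i) = 0)
    (p1 : wt δ1 (false, i + 1) = 1) (q1 : wt δ1 (false, i) = 0)
    {x : ℕ} (hx : x < K + 1) :
    Valid K N (offS f0 x) δ0 c ∨ Valid K N (offS f1 x) δ1 c := by
  have hoff : offS f1 x = offS f0 x := by
    apply Finset.image_congr
    intro p hp
    have h3 := Finset.mem_coe.1 hp
    exact (hsite p (Finset.mem_range.1 (Finset.mem_of_mem_erase h3))).symm
  have hcard := card_offS f0 hx
  have hsub : offS f0 x ⊆ Win K i := hW ▸ offS_sub f0 x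
  have hcase : ¬ (eset K (false, i) ⊆ offS f0 x) ∨ ¬ (eset K (true, i) ⊆ offS f0 x) := by
    by_contra hcon
    push Not at hcon
    have e1 := Finset.eq_of_subset_of_card_le hcon.1 (by rw [card_eset hK]; exact hcard)
    have h3 : i + K ∈ eset K (true, i) := by rw [mem_esetJ]; omega
    have h4 := hcon.2 h3
    rw [← e1, mem_esetI] at h4
    omega
  rw [hoff]
  rcases hcase with hI | hJ
  · left
    refine Valid.of_card hK hcard ?_ ?_
    · intro e he h
      rcases sub_Win hK (he.trans hsub) with rfl | rfl | rfl
      · exact hci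
      · exact absurd he hI
      · rw [r0] at h; exact absurd h (by decide)
    · intro he
      rcases sub_Win hK (he.trans hsub) with h | h | h
      · rwa [h]
      · simp at h; omega
      · simp at h
  · right
    refine Valid.of_card hK hcard ?_ ?_
    · intro e he h
      rcases sub_Win hK (he.trans hsub) with rfl | rfl | rfl
      · exact hci
      · rw [q1] at h; exact absurd h (by decide)
      · exact absurd he hJ
    · intro he
      rcases sub_Win hK (he.trans hsub) with h | h | h
      · rwa [h]
      · simp at h; omega
      · simp at h
/-- All variables allowed. -/
theorem sep_and {K M r N : ℕ} {φ ψ : Fml (sig K (M + r))} {f g : ℕ → Car K M r}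
    (h : Sep N (.and φ ψ) f g) : Sep N φ f g ∨ Sep N ψ f g := by
  unfold Sep at *
  simp only [Fml.Sat] at h
  tauto

theorem sep_or {K M r N : ℕ} {φ ψ : Fml (sig K (M + r))} {f g : ℕ → Car K M r}
    (h : Sep N (.or φ ψ) f g) : Sep N φ f g ∨ Sep N ψ f g := by
  unfold Sep at *
  simp only [Fml.Sat] at h
  tauto

theorem sep_not {K M r N : ℕ} {φ : Fml (sig K (M + r))} {f g : ℕ → Car K M r}
    (h : Sep N (.not φ) f g) : Sep N φ f g := by
  unfold Sep at *
  simp only [Fml.Sat] at h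
  tauto

theorem sep_ex {K M r N : ℕ} {x : ℕ} {ψ : Fml (sig K (M + r))} {f g : ℕ → Car K M r}
    (h : Sep N (.ex x ψ) f g) :
    (∃ a, ∀ b, Sep N ψ (Function.update f x a) (Function.update g x b)) ∨
      (∃ b, ∀ a, Sep N ψ (Function.update f x a) (Function.update g x b)) := by
  unfold Sep at *
  simp only [Fml.Sat] at h
  rcases not_iff.1 h with h'
  by_cases hB : ∃ b, Fml.Sat (Str K M r N 1) (Function.update g x b) ψ
  · have hA := h'.2 hB
    obtain ⟨b, hb⟩ := hB
    right
    refine ⟨b, fun a hab => hA ⟨a, hab.2 hb⟩⟩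
  · left
    have hA := not_not.1 (fun hn => hB (h'.1 hn))
    obtain ⟨a, ha⟩ := hA
    exact ⟨a, fun b hab => hB ⟨b, hab.1 ha⟩⟩

theorem sep_all {K M r N : ℕ} {x : ℕ} {ψ : Fml (sig K (M + r))} {f g : ℕ → Car K M r}
    (h : Sep N (.all x ψ) f g) :
    (∃ a, ∀ b, Sep N ψ (Function.update f x a) (Function.update g x b)) ∨
      (∃ b, ∀ a, Sep N ψ (Function.update f x a) (Function.update g x b)) := by
  have h2 : Sep N (.ex x (.not ψ)) f g := by
    unfold Sep at *
    simp only [Fml.Sat] at *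
    intro h'
    apply h
    rw [← not_iff_not]
    push Not
    exact h'
  rcases sep_ex h2 with ⟨a, ha⟩ | ⟨b, hb⟩
  · exact Or.inl ⟨a, fun b => sep_not (ha b)⟩
  · exact Or.inr ⟨b, fun a => sep_not (hb a)⟩

theorem not_sep_eq {K M r N : ℕ} {f g : ℕ → Car K M r} {δ : Dl K} (hp : Pos f g δ) {i j : ℕ}
    (hi : i < K + 1) (hj : j < K + 1) : ¬ Sep N (.eq i j) f g := by
  unfold Sep
  simp only [Fml.Sat, not_not]
  rw [hp i hi, hp j hj]
  constructor
  · intro h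
    exact congrArg (sh δ) h
  · intro h
    have := congrArg (sh δ) h
    rwa [sh_sh, sh_sh] at this

theorem not_sep_rel {K M r N : ℕ} (hK : 2 ≤ K) (hM : N + K ≤ M) {f g : ℕ → Car K M r} {δ : Dl K}
    {c : ℕ} (hc : 1 ≤ c) (hp : Pos f g δ) (hv : Valid K N (allS f) δ c)
    (R : (sig K (M + r)).symbols) (v : Fin ((sig K (M + r)).arity R) → ℕ)
    (hvv : ∀ m, v m < K + 1) : ¬ Sep N (.rel R v) f g := by
  unfold Sep
  simp only [Fml.Sat, not_not]
  match R, v, hvv with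
  | none, v, hvv =>
    change RelOK N 0 (fun m : Fin (K + 1) => f (v m)) ↔ RelOK N 1 (fun m : Fin (K + 1) => g (v m))
    have e : (fun m : Fin (K + 1) => g (v m)) = fun m : Fin (K + 1) => sh δ (f (v m)) :=
      funext fun m => hp _ (hvv m)
    rw [e]
    apply relOK_sh hK hM hc
    refine hv.mono ?_ le_rfl
    intro s hs
    simp only [tS, Finset.mem_image, Finset.mem_univ, true_and] at hs
    obtain ⟨m, rfl⟩ := hs
    exact Finset.mem_image_of_mem (fun p => site (f p)) (Finset.mem_range.2 (hvv m))
  | some s, v, hvv =>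
    change site (f (v (0 : Fin 1))) = s.val ↔ site (g (v (0 : Fin 1))) = s.val
    rw [hp _ (hvv (0 : Fin 1)), site_sh]

theorem binary_case {K M r N : ℕ} (hK : 2 ≤ K) {φ ψ χ : Fml (sig K (M + r))}
    (hsep : ∀ f g, Sep N χ f g → Sep N φ f g ∨ Sep N ψ f g)
    (hq : χ.quant = φ.quant + ψ.quant)
    (a1 : P1 N φ) (a2 : P2 N φ) (b1 : P1 N ψ) (b2 : P2 N ψ) : P1 N χ ∧ P2 N χ := by
  constructor
  · intro c f g δ hc hp hv hs
    rcases hsep _ _ hs with h | h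
    · have := a1 c f g δ hc hp hv h; omega
    · have := b1 c f g δ hc hp hv h; omega
  · intro c i f0 g0 f1 g1 δ0 δ1 hc hci hi hiN hp0 hp1 hsite hW p0 q0 r0 p1 q1 r1 hs0 hs1
    have hW1 : allS f1 = Win K i := by
      rw [← hW]
      apply Finset.image_congr
      intro p hp
      exact (hsite p (Finset.mem_range.1 (Finset.mem_coe.1 hp))).symm
    have v0 : Valid K N (allS f0) δ0 (min (Nat.fib i) (Nat.fib (N - 2))) := by
      rw [hW]
      refine valid_Win hK p0 (by rw [p0, q0, r0]; decide) hiN ?_ ?_ ?_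
      · exact (min_le_left _ _).trans (Nat.fib_mono (by omega))
      · intro _; exact min_le_left _ _
      · rw [r0]; intro h; exact absurd h (by decide)
    have v1 : Valid K N (allS f1) δ1 (min (Nat.fib (i - 1)) (Nat.fib (N - 2))) := by
      rw [hW1]
      refine valid_Win hK p1 (by rw [p1, q1, r1]; decide) hiN ?_ ?_ ?_
      · exact (min_le_left _ _).trans (Nat.fib_mono (by omega))
      · rw [q1]; intro h; exact absurd h (by decide)
      · intro _; exact min_le_left _ _
    have hfib : Nat.fib (i + 1) = Nat.fib (i - 1) + Nat.fib i := by
      obtain ⟨j, rfl⟩ : ∃ j, i = j + 1 := ⟨i - 1, by omega⟩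
      exact Nat.fib_add_two
    rcases hsep _ _ hs0 with h0 | h0 <;> rcases hsep _ _ hs1 with h1 | h1
    · have := a2 c i f0 g0 f1 g1 δ0 δ1 hc hci hi hiN hp0 hp1 hsite hW p0 q0 r0 p1 q1 r1 h0 h1
      omega
    · have t0 := a1 _ f0 g0 δ0 (min_le_right _ _) hp0 v0 h0
      have t1 := b1 _ f1 g1 δ1 (min_le_right _ _) hp1 v1 h1
      omega
    · have t0 := b1 _ f0 g0 δ0 (min_le_right _ _) hp0 v0 h0
      have t1 := a1 _ f1 g1 δ1 (min_le_right _ _) hp1 v1 h1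
      omega
    · have := b2 c i f0 g0 f1 g1 δ0 δ1 hc hci hi hiN hp0 hp1 hsite hW p0 q0 r0 p1 q1 r1 h0 h1
      omega

theorem quant_case {K M r N : ℕ} (hK : 2 ≤ K) {ψ χ : Fml (sig K (M + r))} {x : ℕ} (hx : x < K + 1)
    (hsep : ∀ f g, Sep N χ f g →
      (∃ a, ∀ b, Sep N ψ (Function.update f x a) (Function.update g x b)) ∨
      (∃ b, ∀ a, Sep N ψ (Function.update f x a) (Function.update g x b)))
    (hq : χ.quant = ψ.quant + 1)
    (a1 : P1 N ψ) (a2 : P2 N ψ) : P1 N χ ∧ P2 N χ := by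
  constructor
  · intro c f g δ hc hp hv hs
    rw [hq]
    exact quant_step hK a1 a2 hx hc (fun p h _ => hp p h) (hv.mono (offS_sub f x) le_rfl)
      (hsep _ _ hs)
  · intro c i f0 g0 f1 g1 δ0 δ1 hc hci hi hiN hp0 hp1 hsite hW p0 q0 r0 p1 q1 r1 hs0 hs1
    rw [hq]
    rcases pair_off hK hci hiN hsite hW p0 r0 p1 q1 hx with hv | hv
    · exact quant_step hK a1 a2 hx hc (fun p h _ => hp0 p h) hv (hsep _ _ hs0)
    · exact quant_step hK a1 a2 hx hc (fun p h _ => hp1 p h) hv (hsep _ _ hs1)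

theorem atom_case {K M r N : ℕ} (hK : 2 ≤ K) {χ : Fml (sig K (M + r))}
    (hsep : ∀ c f g δ, 1 ≤ c → Pos f g δ → Valid K N (allS f) δ c → ¬ Sep N χ f g) :
    P1 N χ ∧ P2 N χ := by
  constructor
  · intro c f g δ _ hp hv hs
    rcases Nat.eq_zero_or_pos c with h | h
    · omega
    · exact absurd hs (hsep c f g δ h hp hv)
  · intro c i f0 g0 f1 g1 δ0 δ1 hc hci hi hiN hp0 hp1 hsite hW p0 q0 r0 p1 q1 r1 hs0 hs1
    exfalso
    refine hsep (Nat.fib i) f0 g0 δ0 (Nat.fib_pos.2 (by omega)) hp0 ?_ hs0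
    rw [hW]
    refine valid_Win hK p0 (by rw [p0, q0, r0]; decide) hiN ?_ ?_ ?_
    · exact Nat.fib_mono (by omega)
    · intro _; exact le_rfl
    · rw [r0]; intro h; exact absurd h (by decide)

theorem lower {K M r N : ℕ} (hK : 2 ≤ K) (hM : N + K ≤ M) (φ : Fml (sig K (M + r)))
    (hu : UsesVars (K + 1) φ) : P1 N φ ∧ P2 N φ := by
  induction φ with
  | eq i j =>
    exact atom_case hK fun c f g δ _ hp _ =>
      not_sep_eq hp (hu i (by simp [Fml.vars])) (hu j (by simp [Fml.vars]))
  | rel R v =>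
    exact atom_case hK fun c f g δ hc hp hv =>
      not_sep_rel hK hM hc hp hv R v (fun m => hu _ (by simp [Fml.vars]))
  | not φ ih =>
    obtain ⟨h1, h2⟩ := ih hu
    constructor
    · intro c f g δ hc hp hv hs
      exact h1 c f g δ hc hp hv (sep_not hs)
    · intro c i f0 g0 f1 g1 δ0 δ1 hc hci hi hiN hp0 hp1 hsite hW p0 q0 r0 p1 q1 r1 hs0 hs1
      exact h2 c i f0 g0 f1 g1 δ0 δ1 hc hci hi hiN hp0 hp1 hsite hW p0 q0 r0 p1 q1 r1
        (sep_not hs0) (sep_not hs1)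
  | and φ ψ ih1 ih2 =>
    obtain ⟨a1, a2⟩ := ih1 (fun i hi => hu i (Finset.mem_union_left _ hi))
    obtain ⟨b1, b2⟩ := ih2 (fun i hi => hu i (Finset.mem_union_right _ hi))
    exact binary_case hK (fun _ _ => sep_and) rfl a1 a2 b1 b2
  | or φ ψ ih1 ih2 =>
    obtain ⟨a1, a2⟩ := ih1 (fun i hi => hu i (Finset.mem_union_left _ hi))
    obtain ⟨b1, b2⟩ := ih2 (fun i hi => hu i (Finset.mem_union_right _ hi))
    exact binary_case hK (fun _ _ => sep_or) rfl a1 a2 b1 b2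
  | ex x ψ ih =>
    obtain ⟨a1, a2⟩ := ih (fun i hi => hu i (Finset.mem_insert_of_mem hi))
    exact quant_case hK (hu x (Finset.mem_insert_self _ _)) (fun _ _ => sep_ex) rfl a1 a2
  | all x ψ ih =>
    obtain ⟨a1, a2⟩ := ih (fun i hi => hu i (Finset.mem_insert_of_mem hi))
    exact quant_case hK (hu x (Finset.mem_insert_self _ _)) (fun _ _ => sep_all) rfl a1 a2

theorem sat_congr {σ : Signature} {A : Struct σ} (φ : Fml σ) :
    ∀ f g : ℕ → A.carrier, (∀ i ∈ φ.freeVars, f i = g i) →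
      (Fml.Sat A f φ ↔ Fml.Sat A g φ) := by
  induction φ with
  | eq i j =>
    intro f g h
    simp only [Fml.Sat]
    rw [h i (by simp [Fml.freeVars]), h j (by simp [Fml.freeVars])]
  | rel R v =>
    intro f g h
    simp only [Fml.Sat]
    rw [show (fun m => f (v m)) = fun m => g (v m) from
      funext fun m => h _ (by simp [Fml.freeVars])]
  | not φ ih =>
    intro f g h
    simp only [Fml.Sat]
    rw [ih f g h]
  | and φ ψ ih1 ih2 =>
    intro f g h
    simp only [Fml.Sat]
    rw [ih1 f g (fun i hi => h i (Finset.mem_union_left _ hi)),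
      ih2 f g (fun i hi => h i (Finset.mem_union_right _ hi))]
  | or φ ψ ih1 ih2 =>
    intro f g h
    simp only [Fml.Sat]
    rw [ih1 f g (fun i hi => h i (Finset.mem_union_left _ hi)),
      ih2 f g (fun i hi => h i (Finset.mem_union_right _ hi))]
  | ex x φ ih =>
    intro f g h
    simp only [Fml.Sat]
    apply exists_congr
    intro a
    apply ih
    intro i hi
    by_cases hix : i = x
    · subst hix; simp
    · simp only [Function.update_of_ne hix]
      exact h i (Finset.mem_erase.2 ⟨hix, hi⟩)
  | all x φ ih =>
    intro f g h
    simp only [Fml.Sat]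
    apply forall_congr'
    intro a
    apply ih
    intro i hi
    by_cases hix : i = x
    · subst hix; simp
    · simp only [Function.update_of_ne hix]
      exact h i (Finset.mem_erase.2 ⟨hix, hi⟩)

theorem satS_iff {σ : Signature} {A : Struct σ} {φ : Fml σ} (h : IsSentence φ)
    (f : ℕ → A.carrier) : SatS A φ ↔ Fml.Sat A f φ := by
  constructor
  · intro hh; exact hh f
  · intro hh g
    refine (sat_congr φ f g ?_).1 hh
    intro i hi
    rw [IsSentence] at h
    rw [h] at hi
    simp at hi

theorem agree {K M r N : ℕ} (hK : 2 ≤ K) (hM : N + K ≤ M) (φ : Fml (sig K (M + r)))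
    (hu : UsesVars (K + 1) φ) (hs : IsSentence φ) (hq : φ.quant < Nat.fib (N - 2)) :
    AgreeOn (Str K M r N 0) (Str K M r N 1) φ := by
  have hM0 : 0 < M := by omega
  let f : ℕ → Car K M r := fun _ => .inl (⟨0, hM0⟩, 0)
  unfold AgreeOn
  rw [satS_iff (A := Str K M r N 0) hs f, satS_iff (A := Str K M r N 1) hs f]
  by_contra hsep
  have hcard : (allS f).card ≤ 1 := by
    refine (Finset.card_le_card (t := {0}) ?_).trans (by simp)
    intro s hs
    simp only [allS, Finset.mem_image] at hs
    obtain ⟨p, _, rfl⟩ := hs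
    simp [f, site]
  have hno : ∀ e, ¬ eset K e ⊆ allS f := by
    intro e he
    have := Finset.card_le_card he
    rw [card_eset hK] at this
    omega
  have := (lower hK hM φ hu).1 (Nat.fib (N - 2)) f f (fun _ => 0) le_rfl ?_ ?_ hsep
  · omega
  · intro p _
    simp [f, sh]
  · exact Valid.of_card hK (by omega) (fun e he => absurd he (hno e)) (fun he => absurd he (hno _))

/-! ## Distinguishability -/

theorem exists_conj {σ : Signature} {B : Struct σ} {A : Struct σ} {k x : ℕ} (hx : x < k)
    {F : Finset ℕ} {ι : Type} (f : ℕ → A.carrier) (g : ι → ℕ → B.carrier) (l : List ι)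
    (h : ∀ b : ι, ∃ φ : Fml σ, UsesVars k φ ∧ φ.freeVars ⊆ F ∧ Fml.Sat A f φ ∧ ¬ Fml.Sat B (g b) φ) :
    ∃ φ : Fml σ, UsesVars k φ ∧ φ.freeVars ⊆ insert x F ∧ Fml.Sat A f φ ∧
      ∀ b ∈ l, ¬ Fml.Sat B (g b) φ := by
  induction l with
  | nil =>
    refine ⟨.eq x x, ?_, ?_, ?_, ?_⟩
    · intro i hi
      simp [Fml.vars] at hi
      omega
    · intro i hi
      simp [Fml.freeVars] at hi
      simp [hi]
    · simp [Fml.Sat]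
    · simp
  | cons b l ih =>
    obtain ⟨φ, h1, h2, h3, h4⟩ := ih
    obtain ⟨ψ, k1, k2, k3, k4⟩ := h b
    refine ⟨.and ψ φ, ?_, ?_, ⟨k3, h3⟩, ?_⟩
    · intro i hi
      rcases Finset.mem_union.1 hi with hi | hi
      · exact k1 i hi
      · exact h1 i hi
    · exact Finset.union_subset (k2.trans (Finset.subset_insert _ _)) h2
    · intro b' hb' hs
      rcases List.mem_cons.1 hb' with rfl | hb'
      · exact k4 hs.1
      · exact h4 b' hb' hs.2

def DistF {σ : Signature} (A B : Struct σ) (k : ℕ) (F : Finset ℕ) (f : ℕ → A.carrier)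
    (g : ℕ → B.carrier) : Prop :=
  ∃ φ : Fml σ, UsesVars k φ ∧ φ.freeVars ⊆ F ∧ Fml.Sat A f φ ∧ ¬ Fml.Sat B g φ

theorem DistF.step {σ : Signature} {A B : Struct σ} [Fintype B.carrier] {k x : ℕ} (hx : x < k)
    {F : Finset ℕ} {f : ℕ → A.carrier} {g : ℕ → B.carrier} (a : A.carrier)
    (h : ∀ b, DistF A B k F (Function.update f x a) (Function.update g x b)) :
    DistF A B k (F.erase x) f g := by
  obtain ⟨φ, h1, h2, h3, h4⟩ := exists_conj hx (Function.update f x a)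
    (fun b => Function.update g x b) (Finset.univ : Finset B.carrier).toList h
  refine ⟨.ex x φ, ?_, ?_, ⟨a, h3⟩, ?_⟩
  · intro i hi
    rcases Finset.mem_insert.1 hi with rfl | hi
    · exact hx
    · exact h1 i hi
  · intro i hi
    obtain ⟨hi1, hi2⟩ := Finset.mem_erase.1 hi
    refine Finset.mem_erase.2 ⟨hi1, ?_⟩
    rcases Finset.mem_insert.1 (h2 hi2) with h | h
    · exact absurd h hi1
    · exact h
  · rintro ⟨b, hb⟩
    exact h4 b (by simp) hb

theorem DistF.mono {σ : Signature} {A B : Struct σ} {k : ℕ} {F G : Finset ℕ} {f : ℕ → A.carrier}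
    {g : ℕ → B.carrier} (h : DistF A B k F f g) (hFG : F ⊆ G) : DistF A B k G f g := by
  obtain ⟨φ, h1, h2, h3, h4⟩ := h
  exact ⟨φ, h1, h2.trans hFG, h3, h4⟩

instance {K M r N : ℕ} {τ : ZMod 2} : Fintype (Str K M r N τ).carrier :=
  inferInstanceAs (Fintype ((Fin M × (Lam K → ZMod 2)) ⊕ Fin r))

structure NE {K M r : ℕ} (N : ℕ) (f g : ℕ → Car K M r) : Prop where
  z : ∀ p, p < K + 1 → bits (f p) = 0
  ne : ¬ DistF (Str K M r N 0) (Str K M r N 1) (K + 1) (Finset.range (K + 1)) f g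

theorem site_lt {K M r : ℕ} (a : Car K M r) : site a < M + r := by
  rcases a with ⟨s, v⟩ | j
  · simp only [site]; omega
  · simp only [site]; omega

theorem NE.site {K M r N : ℕ} {f g : ℕ → Car K M r} (h : NE N f g) {p : ℕ} (hp : p < K + 1) :
    site (g p) = site (f p) := by
  by_contra hne
  apply h.ne
  refine ⟨.rel (some ⟨QVT.site (f p), site_lt _⟩ : Option (Fin (M + r))) (fun _ => p), ?_, ?_, ?_, ?_⟩
  · intro i hi
    simp [Fml.vars] at hi
    omega
  · intro i hi
    simp [Fml.freeVars] at hi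
    simp; omega
  · change QVT.site (f p) = QVT.site (f p)
    rfl
  · exact hne

theorem relOK_zero {K M r N : ℕ} {t : Fin (K + 1) → Car K M r} (h : ∀ m, bits (t m) = 0) :
    RelOK N 0 t := by
  have : ∀ e, tw t e = 0 := by
    intro e
    rw [tw]
    apply Finset.sum_eq_zero
    intro m _
    rw [h m]; rfl
  constructor <;> intros <;> simp [this]

theorem NE.rel {K M r N : ℕ} {f g : ℕ → Car K M r} (h : NE N f g) :
    RelOK N 1 (fun m : Fin (K + 1) => g m) := by
  by_contra hne
  apply h.ne
  refine ⟨.rel (none : Option (Fin (M + r))) (fun m : Fin (K + 1) => (m : ℕ)), ?_, ?_, ?_, ?_⟩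
  · intro i hi
    obtain ⟨m, _, rfl⟩ := Finset.mem_image.1 hi
    exact Fin.is_lt (n := K + 1) m
  · intro i hi
    obtain ⟨m, _, rfl⟩ := Finset.mem_image.1 hi
    exact Finset.mem_range.2 (Fin.is_lt (n := K + 1) m)
  · change RelOK N 0 (fun m : Fin (K + 1) => f m)
    exact relOK_zero (fun m => h.z m m.is_lt)
  · exact hne

theorem NE.move {K M r N : ℕ} {f g : ℕ → Car K M r} (h : NE N f g) {x : ℕ} (hx : x < K + 1)
    (a : Car K M r) (ha : bits a = 0) :
    ∃ b, NE N (Function.update f x a) (Function.update g x b) := by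
  by_contra hne
  push Not at hne
  apply h.ne
  refine (DistF.step hx (F := Finset.range (K + 1)) a ?_).mono (Finset.erase_subset _ _)
  intro b
  by_contra hd
  refine hne b ⟨?_, hd⟩
  intro p hp
  by_cases hpx : p = x
  · subst hpx; simpa using ha
  · rw [Function.update_of_ne hpx]; exact h.z p hp

def Claim (K M r N : ℕ) (e : Bool × ℕ) : Prop :=
  ∀ (f g : ℕ → Car K M r) (x : ℕ), NE N f g → x < K + 1 → offS f x = eset K e →
    ∑ p ∈ (Finset.range (K + 1)).erase x, bits (g p) (lab K e) = 0

theorem tw_off {K M r : ℕ} {g : ℕ → Car K M r} {x : ℕ} (hx : x < K + 1) {e : Bool × ℕ}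
    (h : ∀ p, p < K + 1 → (site (g p) ∈ eset K e ↔ p ≠ x)) :
    tw (fun m : Fin (K + 1) => g m) e
      = ∑ p ∈ (Finset.range (K + 1)).erase x, bits (g p) (lab K e) := by
  rw [tw, Finset.sum_filter,
    Fin.sum_univ_eq_sum_range (fun p => if site (g p) ∈ eset K e then bits (g p) (lab K e) else 0),
    ← Finset.sum_filter]
  apply Finset.sum_congr _ (fun _ _ => rfl)
  ext p
  simp only [Finset.mem_filter, Finset.mem_erase, Finset.mem_range]
  constructor
  · rintro ⟨h1, h2⟩; exact ⟨(h p h1).1 h2, h1⟩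
  · rintro ⟨h1, h2⟩; exact ⟨h2, (h p h2).2 h1⟩

theorem NE.tS {K M r N : ℕ} {f g : ℕ → Car K M r} (h : NE N f g) :
    tS (fun m : Fin (K + 1) => g m) = allS f := by
  ext s
  simp only [QVT.tS, allS, Finset.mem_image, Finset.mem_univ, true_and, Finset.mem_range]
  constructor
  · rintro ⟨m, rfl⟩; exact ⟨m, m.is_lt, (h.site m.is_lt).symm⟩
  · rintro ⟨p, hp, rfl⟩; exact ⟨⟨p, hp⟩, h.site hp⟩

theorem use_claim {K M r N : ℕ} (hK : 2 ≤ K) {e : Bool × ℕ} (hC : Claim K M r N e)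
    {f g : ℕ → Car K M r} (h : NE N f g) {z : ℕ} (hz : z ∉ eset K e)
    (hW : allS f = insert z (eset K e)) : tw (fun m : Fin (K + 1) => g m) e = 0 := by
  have hcard : (allS f).card = K + 1 := by
    rw [hW, Finset.card_insert_of_notMem hz, card_eset hK]
  have hinj : Set.InjOn (fun p => site (f p)) (Finset.range (K + 1) : Finset ℕ) := by
    apply Finset.card_image_iff.1
    rw [Finset.card_range]; exact hcard
  have hzm : z ∈ allS f := by rw [hW]; exact Finset.mem_insert_self _ _
  obtain ⟨y, hy, hyz⟩ := Finset.mem_image.1 hzm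
  have hy' := Finset.mem_range.1 hy
  have key : ∀ p, p < K + 1 → (site (f p) ∈ eset K e ↔ p ≠ y) := by
    intro p hp
    constructor
    · rintro h1 rfl; rw [hyz] at h1; exact hz h1
    · intro hpy
      have : site (f p) ∈ allS f :=
        Finset.mem_image_of_mem (fun p => site (f p)) (Finset.mem_range.2 hp)
      rw [hW] at this
      rcases Finset.mem_insert.1 this with h1 | h1
      · exact absurd (hinj (Finset.mem_coe.2 (Finset.mem_range.2 hp)) (Finset.mem_coe.2 hy)
          (h1.trans hyz.symm)) hpy
      · exact h1
  rw [tw_off hy' (fun p hp => by rw [h.site hp]; exact key p hp)]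
  apply hC f g y h hy'
  ext s
  simp only [offS, Finset.mem_image, Finset.mem_erase, Finset.mem_range]
  constructor
  · rintro ⟨p, ⟨h1, h2⟩, rfl⟩; exact (key p h2).2 h1
  · intro hs
    have : s ∈ allS f := by rw [hW]; exact Finset.mem_insert_of_mem hs
    obtain ⟨p, hp, rfl⟩ := Finset.mem_image.1 this
    have hp := Finset.mem_range.1 hp
    exact ⟨p, ⟨(key p hp).1 hs, hp⟩, rfl⟩

theorem place {K M r N : ℕ} {e : Bool × ℕ} {f g : ℕ → Car K M r} (h : NE N f g) {x : ℕ}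
    (hx : x < K + 1) (ho : offS f x = eset K e) {z : ℕ} (hzM : z < M) (hz : z ∉ eset K e) :
    ∃ f' g' : ℕ → Car K M r, NE N f' g' ∧ allS f' = insert z (eset K e) ∧
      tw (fun m : Fin (K + 1) => g' m) e
        = ∑ p ∈ (Finset.range (K + 1)).erase x, bits (g p) (lab K e) := by
  obtain ⟨b, hb⟩ := h.move hx (.inl (⟨z, hzM⟩, 0)) rfl
  refine ⟨_, _, hb, ?_, ?_⟩
  · rw [← ho]
    ext s
    simp only [offS, allS, Finset.mem_image, Finset.mem_erase, Finset.mem_range,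
      Finset.mem_insert]
    constructor
    · rintro ⟨p, hp, rfl⟩
      by_cases hpx : p = x
      · subst hpx; left; rw [Function.update_self]; rfl
      · right; exact ⟨p, ⟨hpx, hp⟩, by rw [Function.update_of_ne hpx]⟩
    · rintro (rfl | ⟨p, ⟨hpx, hp⟩, rfl⟩)
      · exact ⟨x, hx, by rw [Function.update_self]; rfl⟩
      · exact ⟨p, hp, by rw [Function.update_of_ne hpx]⟩
  · rw [tw_off hx]
    · apply Finset.sum_congr rfl
      intro p hp
      rw [Function.update_of_ne (Finset.mem_erase.1 hp).1]
    · intro p hp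
      rw [hb.site hp]
      by_cases hpx : p = x
      · subst hpx
        rw [Function.update_self]
        simp only [ne_eq, not_true, iff_false]
        exact hz
      · rw [Function.update_of_ne hpx, ← ho]
        simp only [ne_eq, hpx, not_false_iff, iff_true]
        exact Finset.mem_image_of_mem (fun p => site (f p))
          (Finset.mem_erase.2 ⟨hpx, Finset.mem_range.2 hp⟩)

theorem Win_I {K i : ℕ} : Win K i = insert (i + K) (eset K (false, i)) := by
  ext s; rw [Finset.mem_insert, mem_Win, mem_esetI]; omega

theorem Win_I1 {K i : ℕ} : Win K i = insert i (eset K (false, i + 1)) := by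
  ext s; rw [Finset.mem_insert, mem_Win, mem_esetI]; omega

theorem Win_J {K i : ℕ} (hK : 2 ≤ K) : Win K i = insert (i + K - 1) (eset K (true, i)) := by
  ext s; rw [Finset.mem_insert, mem_Win, mem_esetJ]; omega

theorem Win2_I {K i : ℕ} (hK : 2 ≤ K) : Win2 K i = insert (i + K + 1) (eset K (false, i)) := by
  ext s; rw [Finset.mem_insert, mem_Win2 hK, mem_esetI]; omega

theorem claim_all {K M r N : ℕ} (hK : 2 ≤ K) (hN : 1 ≤ N) (hM : N + K ≤ M) (i : ℕ) :
    (i ≤ N → Claim K M r N (false, i)) ∧ (i < N → Claim K M r N (true, i)) := by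
  induction i with
  | zero =>
    constructor
    · intro _ f g x h hx ho
      obtain ⟨f', g', h', hW, ht⟩ := place h hx ho (z := 0 + K) (by omega)
        (by rw [mem_esetI]; omega)
      rw [← ht]
      rw [← Win_I] at hW
      exact (h'.rel.r3 hN (h'.tS.trans hW)).1
    · intro _ f g x h hx ho
      obtain ⟨f', g', h', hW, ht⟩ := place h hx ho (z := 0 + K - 1) (by omega)
        (by rw [mem_esetJ]; omega)
      rw [← ht]
      rw [← Win_J hK] at hW
      exact (h'.rel.r3 hN (h'.tS.trans hW)).2
  | succ i ih =>
    constructor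
    · intro hi f g x h hx ho
      obtain ⟨f', g', h', hW, ht⟩ := place h hx ho (z := i) (by omega)
        (by rw [mem_esetI]; omega)
      rw [← ht]
      rw [← Win_I1] at hW
      rw [h'.rel.r1 i (by omega) (h'.tS.trans hW),
        use_claim hK (ih.1 (by omega)) h' (z := i + K) (by rw [mem_esetI]; omega)
          (hW.trans Win_I),
        use_claim hK (ih.2 (by omega)) h' (z := i + K - 1) (by rw [mem_esetJ]; omega)
          (hW.trans (Win_J hK)), add_zero]
    · intro hi f g x h hx ho
      obtain ⟨f', g', h', hW, ht⟩ := place h hx ho (z := i) (by omega)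
        (by rw [mem_esetJ]; omega)
      rw [← ht]
      change allS f' = Win2 K i at hW
      rw [h'.rel.r2 i (by omega) (h'.tS.trans hW),
        use_claim hK (ih.1 (by omega)) h' (z := i + K + 1) (by rw [mem_esetI]; omega)
          (hW.trans (Win2_I hK))]

theorem dist_full {K M r N : ℕ} (hK : 2 ≤ K) (hN : 1 ≤ N) (hM : N + K ≤ M)
    {f g : ℕ → Car K M r}
    (hf : ∀ p, p < K + 1 → bits (f p) = 0 ∧ site (f p) = N - 1 + p) :
    DistF (Str K M r N 0) (Str K M r N 1) (K + 1) (Finset.range (K + 1)) f g := by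
  by_contra hd
  have h : NE N f g := ⟨fun p hp => (hf p hp).1, hd⟩
  have hW : allS f = Win K (N - 1) := by
    ext s
    rw [mem_Win]
    simp only [allS, Finset.mem_image, Finset.mem_range]
    constructor
    · rintro ⟨p, hp, rfl⟩; rw [(hf p hp).2]; omega
    · intro hs
      exact ⟨s - (N - 1), by omega, by rw [(hf _ (by omega)).2]; omega⟩
  have h1 := h.rel.r4 (N - 1) (by omega) (h.tS.trans hW)
  have hN' : N - 1 + 1 = N := by omega
  have h2 := use_claim hK ((claim_all hK hN hM N).1 le_rfl) h (z := N - 1)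
    (by rw [mem_esetI]; omega) (by rw [hW, Win_I1, hN'])
  rw [h1] at h2
  exact absurd h2 (by decide)

theorem dist_part {K M r N : ℕ} (hK : 2 ≤ K) (hN : 1 ≤ N) (hM : N + K ≤ M) (j : ℕ)
    (hj : j ≤ K + 1) : ∀ f g : ℕ → Car K M r,
    (∀ p, j ≤ p → p < K + 1 → bits (f p) = 0 ∧ site (f p) = N - 1 + p) →
    DistF (Str K M r N 0) (Str K M r N 1) (K + 1) (Finset.Ico j (K + 1)) f g := by
  induction j with
  | zero =>
    intro f g hf
    refine (dist_full hK hN hM (fun p hp => hf p (Nat.zero_le _) hp)).mono ?_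
    intro p hp; simpa using hp
  | succ j ih =>
    intro f g hf
    have hlt : N - 1 + j < M := by omega
    let a : Car K M r := .inl (⟨N - 1 + j, hlt⟩, 0)
    refine (DistF.step (show j < K + 1 by omega) (F := Finset.Ico j (K + 1)) a ?_).mono ?_
    · intro b
      apply ih (by omega)
      intro p h1 h2
      change bits (Function.update (f : ℕ → Car K M r) j a p) = 0 ∧
        site (Function.update (f : ℕ → Car K M r) j a p) = N - 1 + p
      by_cases hp : p = j
      · subst hp
        rw [Function.update_self]
        exact ⟨rfl, rfl⟩
      · rw [Function.update_of_ne hp]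
        exact hf p (by omega) h2
    · intro p hp
      simp only [Finset.mem_erase, Finset.mem_Ico] at hp ⊢
      omega

theorem disting {K M r N : ℕ} (hK : 2 ≤ K) (hN : 1 ≤ N) (hM : N + K ≤ M) :
    ∃ φ : Fml (sig K (M + r)), UsesVars (K + 1) φ ∧ IsSentence φ ∧
      Distinguishes (Str K M r N 0) (Str K M r N 1) φ := by
  have hM0 : 0 < M := by omega
  let f : ℕ → Car K M r := fun _ => .inl (⟨0, hM0⟩, 0)
  obtain ⟨φ, h1, h2, h3, h4⟩ := dist_part hK hN hM (K + 1) le_rfl f f (fun p _ _ => by omega)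
  have hs : IsSentence φ := by
    rw [Finset.Ico_self] at h2
    exact Finset.subset_empty.1 h2
  exact ⟨φ, h1, hs, (satS_iff (A := Str K M r N 0) hs f).2 h3, fun h => h4 (h f)⟩

theorem two_pow_le_fib (m : ℕ) : 2 ^ m ≤ Nat.fib (2 * m + 1) := by
  induction m with
  | zero => simp
  | succ m ih =>
    have h1 : Nat.fib (2 * (m + 1) + 1) = Nat.fib (2 * m + 1) + Nat.fib (2 * m + 2) :=
      Nat.fib_add_two
    have h2 : Nat.fib (2 * m + 1) ≤ Nat.fib (2 * m + 2) := Nat.fib_mono (by omega)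
    rw [pow_succ]
    omega

theorem card_Str {K M r N : ℕ} {τ : ZMod 2} :
    Nat.card (Str K M r N τ).carrier = M * 2 ^ (2 * (K + 1)) + r := by
  change Nat.card ((Fin M × (Lam K → ZMod 2)) ⊕ Fin r) = _
  simp [Lam]

theorem main_aux (K : ℕ) (hK : 2 ≤ K) :
    ∃ ε : ℝ, 0 < ε ∧ ∃ n₀ : ℕ, ∀ n : ℕ, n₀ < n →
      ∃ σ : Signature, (∀ R : σ.symbols, σ.arity R ≤ K + 1) ∧
        ∃ A B : Struct σ,
          Nat.card A.carrier = n ∧ Nat.card B.carrier = n ∧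
          (∃ φ : Fml σ, UsesVars (K + 1) φ ∧ IsSentence φ ∧ Distinguishes A B φ) ∧
          ∀ φ : Fml σ, UsesVars (K + 1) φ → IsSentence φ →
            (φ.quant : ℝ) < (2 : ℝ) ^ (ε * n) → AgreeOn A B φ := by
  obtain ⟨D, hD⟩ : ∃ D : ℕ, D = 2 ^ (2 * (K + 1)) := ⟨_, rfl⟩
  have hD0 : 0 < D := by rw [hD]; positivity
  have hDr : (0 : ℝ) < D := by exact_mod_cast hD0
  refine ⟨1 / (8 * D), by positivity, 2 * (3 + K) * D + 4 * D, ?_⟩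
  intro n hn
  obtain ⟨m, hm⟩ : ∃ m, m = n / (4 * D) := ⟨_, rfl⟩
  have hm1 : m * (4 * D) ≤ n := by rw [hm]; exact Nat.div_mul_le_self _ _
  have hm2 : n < (m + 1) * (4 * D) := by
    exact (Nat.div_lt_iff_lt_mul (by omega)).1 (by omega)
  have hm3 : 1 ≤ m := by
    by_contra h
    have : m = 0 := by omega
    subst this
    nlinarith
  have hMD : (2 * m + 3 + K) * D ≤ n := by nlinarith
  obtain ⟨r, hr⟩ : ∃ r, n = (2 * m + 3 + K) * D + r := ⟨_, (Nat.add_sub_of_le hMD).symm⟩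
  refine ⟨sig K (2 * m + 3 + K + r), ?_, Str K (2 * m + 3 + K) r (2 * m + 3) 0,
    Str K (2 * m + 3 + K) r (2 * m + 3) 1, ?_, ?_, disting hK (by omega) le_rfl, ?_⟩
  · intro R
    match R with
    | none => exact le_rfl
    | some s => exact Nat.le_add_left 1 K
  · rw [card_Str, ← hD, hr]
  · rw [card_Str, ← hD, hr]
  · intro φ hu hs hq
    apply agree hK le_rfl φ hu hs
    have h1 : (1 / (8 * (D : ℝ))) * n ≤ m := by
      have h2 : (n : ℝ) ≤ (m + 1) * (4 * D) := by exact_mod_cast hm2.le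
      have h3 : (1 : ℝ) ≤ m := by exact_mod_cast hm3
      rw [one_div, inv_mul_le_iff₀ (by positivity)]
      nlinarith
    have h2 : (2 : ℝ) ^ ((1 / (8 * (D : ℝ))) * n) ≤ (2 : ℝ) ^ m := by
      rw [← Real.rpow_natCast]
      exact Real.rpow_le_rpow_of_exponent_le (by norm_num) h1
    have h3 : (φ.quant : ℝ) < ((2 ^ m : ℕ) : ℝ) := by
      push_cast
      exact hq.trans_le h2
    have h4 : φ.quant < 2 ^ m := by exact_mod_cast h3
    exact h4.trans_le (two_pow_le_fib m)

/-- Theorem 1 of the paper. For every integer `k ≥ 3` there exist a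
real `ε > 0` and a natural number `n₀` such that for every `n > n₀` there are a finite
relational signature `σ` all of whose relation symbols have arity at most `k`, and two
`σ`-structures `A, B` with `|A| = |B| = n`, such that some sentence of `L^k`
distinguishes `A` from `B`, yet `A` and `B` agree on every sentence `φ` of `L^k` with
`quant φ < 2 ^ (ε * n)`. -/
theorem statement_0 (k : ℕ) (hk : 3 ≤ k) :
    ∃ ε : ℝ, 0 < ε ∧ ∃ n₀ : ℕ, ∀ n : ℕ, n₀ < n →
      ∃ σ : Signature, (∀ R : σ.symbols, σ.arity R ≤ k) ∧
        ∃ A B : Struct σ,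
          Nat.card A.carrier = n ∧ Nat.card B.carrier = n ∧
          (∃ φ : Fml σ, UsesVars k φ ∧ IsSentence φ ∧ Distinguishes A B φ) ∧
          ∀ φ : Fml σ, UsesVars k φ → IsSentence φ →
            (φ.quant : ℝ) < (2 : ℝ) ^ (ε * n) → AgreeOn A B φ := by
  obtain ⟨K, rfl⟩ : ∃ K, k = K + 1 := ⟨k - 1, by omega⟩
  exact main_aux K (by omega)

end QVT
end

section
/- For every integer k ≥ 3 there exists a real ε > 0 such that for every natural number n there are a finite relational signature σ and a sentence φ of L^{k+1} over σ with |φ| ≥ n, such that φ is logically equivalent over the class of all σ-structures to some sentence of L^k, yet every sentence ψ of L^k that is logically equivalent to φ over all σ-structures satisfies |ψ| ≥ 2^{ε·|φ|}. -/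
namespace QVT

/-! ### Helpers on formulas -/

section FmlHelpers

variable {σ : Signature}

/-- Quantified subformulas `(v, χ)`; a universal quantifier is recorded with negated body. -/
def qs : Fml σ → List (ℕ × Fml σ)
  | .eq _ _ => []
  | .rel _ _ => []
  | .not φ => qs φ
  | .and φ ψ => qs φ ++ qs ψ
  | .or φ ψ => qs φ ++ qs ψ
  | .ex i φ => (i, φ) :: qs φ
  | .all i φ => (i, .not φ) :: qs φ

theorem qs_length (φ : Fml σ) : (qs φ).length ≤ φ.size := by
  induction φ <;> simp [qs, Fml.size] <;> omega

/-- Existentially quantify the variables `0, …, n-1`. -/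
def exN : ℕ → Fml σ → Fml σ
  | 0, φ => φ
  | n + 1, φ => exN n (.ex n φ)

theorem exN_size (n : ℕ) (φ : Fml σ) : (exN n φ).size = φ.size + 2 * n := by
  induction n generalizing φ with
  | zero => rfl
  | succ n ih => rw [exN, ih]; simp [Fml.size]; omega

theorem exN_vars (n k : ℕ) (φ : Fml σ) (hn : n ≤ k) (h : UsesVars k φ) :
    UsesVars k (exN n φ) := by
  induction n generalizing φ with
  | zero => exact h
  | succ n ih =>
    rw [exN]
    apply ih _ (by omega)
    intro i hi
    simp only [Fml.vars, Finset.mem_insert] at hi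
    rcases hi with rfl | hi
    · omega
    · exact h i hi

theorem exN_free (n : ℕ) (φ : Fml σ) (h : ∀ i ∈ φ.freeVars, i < n) :
    IsSentence (exN n φ) := by
  induction n generalizing φ with
  | zero =>
    rw [exN, IsSentence, Finset.eq_empty_iff_forall_notMem]
    intro i hi
    exact absurd (h i hi) (by omega)
  | succ n ih =>
    rw [exN]
    apply ih
    intro i hi
    simp only [Fml.freeVars, Finset.mem_erase] at hi
    have := h i hi.2
    omega

theorem exN_sat (M : Struct σ) (n : ℕ) (φ : Fml σ) (f : ℕ → M.carrier) :
    Fml.Sat M f (exN n φ) ↔ ∃ g : ℕ → M.carrier, (∀ i, n ≤ i → g i = f i) ∧ Fml.Sat M g φ := by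
  induction n generalizing φ with
  | zero =>
    rw [exN]
    constructor
    · intro h
      exact ⟨f, fun _ _ => rfl, h⟩
    · rintro ⟨g, hg, h⟩
      have : g = f := funext fun i => hg i (Nat.zero_le i)
      rwa [this] at h
  | succ n ih =>
    rw [exN, ih]
    constructor
    · rintro ⟨g, hg, a, ha⟩
      refine ⟨Function.update g n a, ?_, ha⟩
      intro i hi
      rw [Function.update_of_ne (by omega)]
      exact hg i (by omega)
    · rintro ⟨g, hg, h⟩
      refine ⟨Function.update g n (f n), ?_, g n, ?_⟩
      · intro i hi
        by_cases hin : i = n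
        · subst hin; simp
        · rw [Function.update_of_ne hin]
          exact hg i (by omega)
      · simpa using h

/-- Finite conjunction. -/
def bigAnd : List (Fml σ) → Fml σ
  | [] => .eq 0 0
  | φ :: l => .and φ (bigAnd l)

/-- Finite disjunction. -/
def bigOr : List (Fml σ) → Fml σ
  | [] => .not (.eq 0 0)
  | φ :: l => .or φ (bigOr l)

theorem bigAnd_sat (M : Struct σ) (f : ℕ → M.carrier) (l : List (Fml σ)) :
    Fml.Sat M f (bigAnd l) ↔ ∀ φ ∈ l, Fml.Sat M f φ := by
  induction l <;> simp_all [bigAnd, Fml.Sat]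

theorem bigOr_sat (M : Struct σ) (f : ℕ → M.carrier) (l : List (Fml σ)) :
    Fml.Sat M f (bigOr l) ↔ ∃ φ ∈ l, Fml.Sat M f φ := by
  induction l <;> simp_all [bigOr, Fml.Sat]

theorem bigAnd_vars (l : List (Fml σ)) (k : ℕ) (hk : 0 < k) (h : ∀ φ ∈ l, UsesVars k φ) :
    UsesVars k (bigAnd l) := by
  induction l with
  | nil => intro i hi; simp [bigAnd, Fml.vars] at hi; omega
  | cons a l ih =>
    intro i hi
    simp only [bigAnd, Fml.vars, Finset.mem_union] at hi
    rcases hi with hi | hi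
    · exact h a (by simp) i hi
    · exact ih (fun φ hφ => h φ (by simp [hφ])) i hi

theorem bigOr_vars (l : List (Fml σ)) (k : ℕ) (hk : 0 < k) (h : ∀ φ ∈ l, UsesVars k φ) :
    UsesVars k (bigOr l) := by
  induction l with
  | nil => intro i hi; simp [bigOr, Fml.vars] at hi; omega
  | cons a l ih =>
    intro i hi
    simp only [bigOr, Fml.vars, Finset.mem_union] at hi
    rcases hi with hi | hi
    · exact h a (by simp) i hi
    · exact ih (fun φ hφ => h φ (by simp [hφ])) i hi

theorem free_sub (φ : Fml σ) : φ.freeVars ⊆ φ.vars := by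
  induction φ with
  | eq i j => exact subset_rfl
  | rel R v => exact subset_rfl
  | not φ ih => exact ih
  | and φ ψ h1 h2 => exact Finset.union_subset_union h1 h2
  | or φ ψ h1 h2 => exact Finset.union_subset_union h1 h2
  | ex i φ ih => exact (Finset.erase_subset _ _).trans (ih.trans (Finset.subset_insert _ _))
  | all i φ ih => exact (Finset.erase_subset _ _).trans (ih.trans (Finset.subset_insert _ _))

theorem bigAnd_size (l : List (Fml σ)) (h : ∀ φ ∈ l, φ.size = 13) :
    (bigAnd l).size = 14 * l.length + 3 := by
  induction l with
  | nil => rfl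
  | cons a l ih =>
    simp only [bigAnd, Fml.size, List.length_cons]
    rw [ih fun φ hφ => h φ (by simp [hφ]), h a (by simp)]
    omega

end FmlHelpers

/-! ### The signature and the sentences -/

/-- `m` unary symbols and two symbols of arity `d+1`. -/
def sg (m d : ℕ) : Signature where
  symbols := Fin m ⊕ Bool
  fin := inferInstance
  arity := fun R => match R with
    | .inl _ => 1
    | .inr _ => d + 1

/-- The unary atom `U_i(v)`. -/
def atU {m d : ℕ} (i : Fin m) (v : ℕ) : Fml (sg m d) :=
  .rel (σ := sg m d) (.inl i) (fun _ => v)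

/-- The atom `R_b(v, x_1, …, x_d)`. -/
def atR {m d : ℕ} (b : Bool) (v : ℕ) : Fml (sg m d) :=
  .rel (σ := sg m d) (.inr b) (Fin.cons v (fun l : Fin d => l.val + 1) : Fin (d + 1) → ℕ)

/-- `U_i(u) ↔ U_i(v)`. -/
def iffU {m d : ℕ} (u v : ℕ) (i : Fin m) : Fml (sg m d) :=
  .or (.and (atU i u) (atU i v)) (.and (.not (atU i u)) (.not (atU i v)))

/-- The short `(d+2)`-variable sentence. -/
def phi (m d : ℕ) : Fml (sg m d) :=
  exN (d + 2) (.and (atR true 0) (.and (atR false (d + 1))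
    (bigAnd ((List.finRange m).map (iffU 0 (d + 1))))))

/-- literal -/
def litU {m d : ℕ} (a : Fin m → Bool) (i : Fin m) : Fml (sg m d) :=
  if a i then atU i 0 else .not (atU i 0)

/-- some `x_0` with label `a` is in relation `R_b` with `x_1, …, x_d` -/
def partF {m d : ℕ} (b : Bool) (a : Fin m → Bool) : Fml (sg m d) :=
  .ex 0 (.and (atR b 0) (bigAnd ((List.finRange m).map (litU a))))

/-- The long `(d+1)`-variable sentence. -/
noncomputable def psi (m d : ℕ) : Fml (sg m d) :=
  exN (d + 1) (bigOr ((Finset.univ : Finset (Fin m → Bool)).toList.map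
    (fun a => .and (partF true a) (partF false a))))

theorem atR_vars {m d : ℕ} (b : Bool) (v k : ℕ) (hv : v < k) (hd : d < k) :
    UsesVars k (atR b v : Fml (sg m d)) := by
  intro i hi
  obtain ⟨j, -, rfl⟩ := Finset.mem_image.1 hi
  clear hi; revert j
  intro (j : Fin (d + 1))
  refine Fin.cases ?_ (fun l => ?_) j
  · simpa using hv
  · simp only [Fin.cons_succ]
    omega

theorem atU_vars {m d : ℕ} (i : Fin m) (v k : ℕ) (hv : v < k) :
    UsesVars k (atU i v : Fml (sg m d)) := by
  intro j hj
  simp only [atU, Fml.vars, Finset.mem_image] at hj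
  obtain ⟨_, -, rfl⟩ := hj
  exact hv

theorem and_vars {σ : Signature} {k : ℕ} {φ ψ : Fml σ} (h1 : UsesVars k φ) (h2 : UsesVars k ψ) :
    UsesVars k (.and φ ψ) := by
  intro i hi
  simp only [Fml.vars, Finset.mem_union] at hi
  exact hi.elim (h1 i) (h2 i)

theorem or_vars {σ : Signature} {k : ℕ} {φ ψ : Fml σ} (h1 : UsesVars k φ) (h2 : UsesVars k ψ) :
    UsesVars k (.or φ ψ) := by
  intro i hi
  simp only [Fml.vars, Finset.mem_union] at hi
  exact hi.elim (h1 i) (h2 i)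

theorem phi_body_vars (m d : ℕ) : UsesVars (d + 2) (.and (atR true 0) (.and (atR false (d + 1))
    (bigAnd ((List.finRange m).map (iffU 0 (d + 1))))) : Fml (sg m d)) := by
  refine and_vars (atR_vars _ _ _ (by omega) (by omega))
    (and_vars (atR_vars _ _ _ (by omega) (by omega)) (bigAnd_vars _ _ (by omega) ?_))
  intro φ hφ
  simp only [List.mem_map] at hφ
  obtain ⟨i, -, rfl⟩ := hφ
  exact or_vars (and_vars (atU_vars _ _ _ (by omega)) (atU_vars _ _ _ (by omega)))
    (and_vars (φ := .not _) (ψ := .not _) (atU_vars i 0 _ (by omega)) (atU_vars i _ _ (by omega)))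

theorem phi_vars (m d : ℕ) : UsesVars (d + 2) (phi m d) :=
  exN_vars _ _ _ le_rfl (phi_body_vars m d)

theorem phi_sentence (m d : ℕ) : IsSentence (phi m d) :=
  exN_free _ _ fun i hi => phi_body_vars m d i (free_sub _ hi)

theorem phi_size (m d : ℕ) : (phi m d).size = 14 * m + 4 * d + 13 := by
  rw [phi, exN_size]
  simp only [Fml.size]
  rw [bigAnd_size]
  · have h : ∀ b v, (atR b v : Fml (sg m d)).size = 1 + (d + 1) := fun _ _ => rfl
    rw [h, h, List.length_map, List.length_finRange]
    omega
  · intro φ hφ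
    simp only [List.mem_map] at hφ
    obtain ⟨i, -, rfl⟩ := hφ
    simp [iffU, atU, Fml.size, sg]

theorem psi_body_vars (m d : ℕ) :
    UsesVars (d + 1) (bigOr ((Finset.univ : Finset (Fin m → Bool)).toList.map
    (fun a => .and (partF true a) (partF false a))) : Fml (sg m d)) := by
  have key : ∀ b a, UsesVars (d + 1) (partF b a : Fml (sg m d)) := by
    intro b a i hi
    simp only [partF, Fml.vars, Finset.mem_insert] at hi
    rcases hi with rfl | hi
    · omega
    · refine and_vars (atR_vars b 0 _ (by omega) (by omega))
        (bigAnd_vars ((List.finRange m).map (litU a)) _ (by omega) ?_) i hi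
      intro φ hφ
      simp only [List.mem_map] at hφ
      obtain ⟨i, -, rfl⟩ := hφ
      unfold litU
      split
      · exact atU_vars _ _ _ (by omega)
      · exact atU_vars (d := d) i 0 _ (by omega)
  refine bigOr_vars _ _ (by omega) ?_
  intro φ hφ
  simp only [List.mem_map] at hφ
  obtain ⟨i, -, rfl⟩ := hφ
  exact and_vars (key _ _) (key _ _)

theorem psi_vars (m d : ℕ) : UsesVars (d + 1) (psi m d) :=
  exN_vars _ _ _ le_rfl (psi_body_vars m d)

theorem psi_sentence (m d : ℕ) : IsSentence (psi m d) :=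
  exN_free _ _ fun i hi => psi_body_vars m d i (free_sub _ hi)

/-- semantic reading of unary symbols -/
def relU {m d : ℕ} (M : Struct (sg m d)) (i : Fin m) (c : M.carrier) : Prop :=
  M.rel (.inl i : Fin m ⊕ Bool) (fun _ => c)

/-- semantic reading of the `(d+1)`-ary symbols -/
def relR {m d : ℕ} (M : Struct (sg m d)) (b : Bool) (c : M.carrier) (z : Fin d → M.carrier) : Prop :=
  M.rel (.inr b : Fin m ⊕ Bool) (Fin.cons c z : Fin (d + 1) → M.carrier)

theorem atU_sat {m d : ℕ} (M : Struct (sg m d)) (f : ℕ → M.carrier) (i : Fin m) (v : ℕ) :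
    Fml.Sat M f (atU i v) ↔ relU M i (f v) := Iff.rfl

theorem atR_sat {m d : ℕ} (M : Struct (sg m d)) (f : ℕ → M.carrier) (b : Bool) (v : ℕ) :
    Fml.Sat M f (atR b v) ↔ relR M b (f v) (fun l => f (l.val + 1)) := by
  unfold atR relR
  simp only [Fml.Sat]
  apply iff_of_eq
  congr 1
  funext (j : Fin (d + 1))
  refine Fin.cases ?_ (fun l => ?_) j <;> simp

/-- The property both sentences express. -/
def Prp {m d : ℕ} (M : Struct (sg m d)) : Prop :=
  ∃ (c e : M.carrier) (z : Fin d → M.carrier), relR M true c z ∧ relR M false e z ∧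
    ∀ i, relU M i c ↔ relU M i e

theorem phi_sat {m d : ℕ} (M : Struct (sg m d)) (f : ℕ → M.carrier) :
    Fml.Sat M f (phi m d) ↔ Prp M := by
  rw [phi, exN_sat]
  simp only [Fml.Sat, atR_sat, bigAnd_sat, List.mem_map, List.mem_finRange, true_and,
    forall_exists_index, forall_apply_eq_imp_iff, iffU, atU_sat]
  constructor
  · rintro ⟨g, -, h1, h2, h3⟩
    exact ⟨_, _, _, h1, h2, fun i => by have := h3 i; tauto⟩
  · rintro ⟨c, e, z, h1, h2, h3⟩
    refine ⟨fun i => if h0 : i = 0 then c else if h : i - 1 < d then z ⟨i - 1, h⟩ else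
      if i = d + 1 then e else f i, ?_, ?_, ?_, ?_⟩
    · intro i hi
      dsimp only
      rw [dif_neg (by omega), dif_neg (by omega), if_neg (by omega)]
    · simpa using h1
    · simpa using h2
    · intro i
      have := h3 i
      simp
      tauto

theorem litU_sat {m d : ℕ} (M : Struct (sg m d)) (f : ℕ → M.carrier) (a : Fin m → Bool)
    (i : Fin m) : Fml.Sat M f (litU a i) ↔ (relU M i (f 0) ↔ a i = true) := by
  unfold litU
  split <;> rename_i h <;> simp [h, Fml.Sat, atU_sat]

theorem partF_sat {m d : ℕ} (M : Struct (sg m d)) (f : ℕ → M.carrier) (b : Bool)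
    (a : Fin m → Bool) : Fml.Sat M f (partF b a) ↔
      ∃ c, relR M b c (fun l => f (l.val + 1)) ∧ ∀ i, relU M i c ↔ a i = true := by
  simp only [partF, Fml.Sat, atR_sat, bigAnd_sat, List.mem_map, List.mem_finRange, true_and,
    forall_exists_index, forall_apply_eq_imp_iff, litU_sat]
  simp

open Classical in
theorem psi_sat {m d : ℕ} (M : Struct (sg m d)) (f : ℕ → M.carrier) :
    Fml.Sat M f (psi m d) ↔ Prp M := by
  rw [psi, exN_sat]
  simp only [bigOr_sat, List.mem_map, Finset.mem_toList, Finset.mem_univ, true_and,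
    exists_exists_eq_and, Fml.Sat, partF_sat]
  constructor
  · rintro ⟨g, -, a, ⟨c, h1, h2⟩, e, h3, h4⟩
    exact ⟨c, e, _, h1, h3, fun i => (h2 i).trans (h4 i).symm⟩
  · rintro ⟨c, e, z, h1, h2, h3⟩
    refine ⟨fun i => if h0 : i = 0 then c else if h : i - 1 < d then z ⟨i - 1, h⟩ else f i, ?_,
      fun i => decide (relU M i c), ⟨c, ?_, ?_⟩, ⟨e, ?_, ?_⟩⟩
    · intro i hi
      dsimp only
      rw [dif_neg (by omega), dif_neg (by omega)]
    · simpa using h1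
    · simp
    · simpa using h2
    · intro i
      simp [h3 i]

/-! ### The structures -/

/-- Labels. -/
abbrev Lab (m : ℕ) := Fin m → Bool

/-- Sets of labels, as a group. -/
abbrev Gam (m : ℕ) := Lab m → ZMod 2

/-- Elements of the structures. -/
inductive El (m d : ℕ) : Type
  | L : Bool → Lab m → El m d
  | Z : Fin d → Gam m → El m d

namespace El

variable {m d : ℕ}

/-- unary predicates -/
def bit (i : Fin m) : El m d → Prop
  | L _ a => a i = true
  | Z _ _ => False

/-- shift each sort -/
def sh (t : Fin d → Gam m) : El m d → El m d
  | L b a => L b a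
  | Z l x => Z l (x + t l)

theorem sh_neg (t : Fin d → Gam m) (a : El m d) : sh (-t) (sh t a) = a := by
  cases a <;> simp [sh]

theorem sh_neg' (t : Fin d → Gam m) (a : El m d) : sh t (sh (-t) a) = a := by
  cases a <;> simp [sh]

theorem sh_zero (a : El m d) : sh 0 a = a := by
  cases a <;> simp [sh]

theorem sh_inj (t : Fin d → Gam m) {a b : El m d} : sh t a = sh t b ↔ a = b :=
  ⟨fun h => by rw [← sh_neg t a, h, sh_neg], fun h => by rw [h]⟩

theorem sh_L (t : Fin d → Gam m) {a : El m d} {b : Bool} {x : Lab m} :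
    sh t a = L b x ↔ a = L b x := by
  cases a <;> simp [sh]

theorem sh_Z (t : Fin d → Gam m) {a : El m d} {l : Fin d} {x : Gam m} :
    sh t a = Z l x ↔ a = Z l (x - t l) := by
  cases a with
  | L => simp [sh]
  | Z l' y =>
    simp only [sh, Z.injEq]
    constructor
    · rintro ⟨rfl, rfl⟩; simp
    · rintro ⟨rfl, rfl⟩; simp

theorem sh_bit (t : Fin d → Gam m) (i : Fin m) (a : El m d) : bit i (sh t a) ↔ bit i a := by
  cases a <;> simp [sh, bit]

/-- Is the element in the second label sort? -/
def IsE : El m d → Prop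
  | L b _ => b = false
  | Z _ _ => False

theorem sh_IsE (t : Fin d → Gam m) (a : El m d) : IsE (sh t a) ↔ IsE a := by
  cases a <;> simp [sh, IsE]

instance : Finite (El m d) := by
  have : Function.Injective (fun a : El m d =>
      (match a with
        | L b x => Sum.inl (b, x)
        | Z l x => Sum.inr (l, x) : (Bool × Lab m) ⊕ (Fin d × Gam m))) := by
    intro a b h
    cases a <;> cases b <;> simp_all
  exact Finite.of_injective _ this

instance : Nonempty (El m d) := ⟨L true fun _ => true⟩

end El

/-- condition for the relation `R_b` -/
def Hld {m : ℕ} (π : Gam m → Gam m) (b : Bool) (s : Gam m) (a : Lab m) : Prop :=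
  if b then s a = 1 else π s a ≠ 1

/-- The structure with permuted second components. -/
def St (m d : ℕ) (π : Gam m → Gam m) : Struct (sg m d) where
  carrier := El m d
  rel := fun R => match R with
    | .inl i => fun x : Fin 1 → El m d => (x 0).bit i
    | .inr b => fun x : Fin (d + 1) → El m d => ∃ (a : Lab m) (y : Fin d → Gam m),
        x 0 = .L b a ∧ (∀ l : Fin d, x l.succ = .Z l (y l)) ∧ Hld π b (∑ l, y l) a

theorem St_U {m d : ℕ} (π : Gam m → Gam m) (i : Fin m) (c : El m d) :
    relU (St m d π) i c ↔ c.bit i := Iff.rfl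

theorem St_R {m d : ℕ} (π : Gam m → Gam m) (b : Bool) (c : El m d) (z : Fin d → El m d) :
    relR (St m d π) b c z ↔ ∃ (a : Lab m) (y : Fin d → Gam m),
        c = .L b a ∧ (∀ l : Fin d, z l = .Z l (y l)) ∧ Hld π b (∑ l, y l) a := by
  unfold relR
  simp only [St]
  simp

theorem sum_single {m d : ℕ} (hd : 0 < d) (s : Gam m) :
    ∑ l : Fin d, (if l = ⟨0, hd⟩ then s else 0) = s := by simp

theorem Prp_St {m d : ℕ} (hd : 0 < d) (π : Gam m → Gam m) :
    Prp (St m d π) ↔ ∃ (s : Gam m) (a : Lab m), s a = 1 ∧ π s a ≠ 1 := by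
  constructor
  · rintro ⟨c, e, z, h1, h2, h3⟩
    obtain ⟨a, y, rfl, hz, h1⟩ := (St_R π true c z).1 h1
    obtain ⟨a', y', rfl, hz', h2⟩ := (St_R π false e z).1 h2
    have hy : y = y' := by
      funext l
      have := (hz l).symm.trans (hz' l)
      simpa using this
    subst hy
    have ha : a = a' := by
      funext i
      have := h3 i
      rw [St_U, St_U] at this
      simp only [El.bit] at this
      exact Bool.eq_iff_iff.mpr this
    subst ha
    exact ⟨∑ l, y l, a, by simpa [Hld] using h1, by simpa [Hld] using h2⟩
  · rintro ⟨s, a, h1, h2⟩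
    refine ⟨El.L true a, El.L false a, fun l => El.Z l (if l = ⟨0, hd⟩ then s else 0), ?_, ?_, ?_⟩
    · rw [St_R]
      exact ⟨a, _, rfl, fun l => rfl, by rw [sum_single]; simpa [Hld] using h1⟩
    · rw [St_R]
      exact ⟨a, _, rfl, fun l => rfl, by rw [sum_single]; simpa [Hld] using h2⟩
    · intro i
      rw [St_U, St_U]
      rfl

theorem update_rel {m d : ℕ} {f f' : ℕ → El m d} {t : Fin d → Gam m} {v : ℕ} {a : El m d}
    (h : ∀ i < d + 1, i ≠ v → f' i = (f i).sh t) :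
    ∀ i < d + 1, Function.update f' v (a.sh t) i = (Function.update f v a i).sh t := by
  intro i hi
  by_cases hv : i = v
  · subst hv; simp
  · simp [Function.update_of_ne hv, h i hi hv]

/-- Satisfaction in `St`, with concrete carrier. -/
def SE {m d : ℕ} (π : Gam m → Gam m) (f : ℕ → El m d) (χ : Fml (sg m d)) : Prop :=
  Fml.Sat (St m d π) f χ

section SatEl

variable {m d : ℕ} (π : Gam m → Gam m) (f : ℕ → El m d)

theorem SE_eq (i j : ℕ) : SE π f (.eq i j) ↔ f i = f j := Iff.rfl

theorem SE_not (φ : Fml (sg m d)) : SE π f (.not φ) ↔ ¬ SE π f φ := Iff.rfl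

theorem SE_and (φ ψ : Fml (sg m d)) : SE π f (.and φ ψ) ↔ SE π f φ ∧ SE π f ψ := Iff.rfl

theorem SE_or (φ ψ : Fml (sg m d)) : SE π f (.or φ ψ) ↔ SE π f φ ∨ SE π f ψ := Iff.rfl

theorem SE_ex (v : ℕ) (φ : Fml (sg m d)) :
    SE π f (.ex v φ) ↔ ∃ a : El m d, SE π (Function.update f v a) φ := Iff.rfl

theorem SE_all (v : ℕ) (φ : Fml (sg m d)) :
    SE π f (.all v φ) ↔ ∀ a : El m d, SE π (Function.update f v a) φ := Iff.rfl

/-- unary atom with typed argument -/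
def fU (i : Fin m) (v : Fin 1 → ℕ) : Fml (sg m d) := .rel (σ := sg m d) (.inl i) v

/-- `(d+1)`-ary atom with typed argument -/
def fR (b : Bool) (v : Fin (d + 1) → ℕ) : Fml (sg m d) := .rel (σ := sg m d) (.inr b) v

theorem SE_U (i : Fin m) (v : Fin 1 → ℕ) : SE π f (fU i v) ↔ (f (v 0)).bit i := Iff.rfl

theorem SE_R (b : Bool) (v : Fin (d + 1) → ℕ) : SE π f (fR b v) ↔
    ∃ (a : Lab m) (y : Fin d → Gam m), f (v 0) = .L b a ∧
      (∀ l : Fin d, f (v l.succ) = .Z l (y l)) ∧ Hld π b (∑ l, y l) a := Iff.rfl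

theorem fU_vars {k : ℕ} {i : Fin m} {v : Fin 1 → ℕ} (h : UsesVars k (fU i v : Fml (sg m d)))
    (j : Fin 1) : v j < k :=
  h _ (Finset.mem_image_of_mem v (Finset.mem_univ j))

theorem fR_vars {k : ℕ} {b : Bool} {v : Fin (d + 1) → ℕ}
    (h : UsesVars k (fR b v : Fml (sg m d))) (j : Fin (d + 1)) : v j < k :=
  h _ (Finset.mem_image_of_mem v (Finset.mem_univ j))

/-- Induction principle with typed atoms. -/
theorem sg_ind {P : Fml (sg m d) → Prop} (eq : ∀ i j, P (.eq i j)) (U : ∀ i v, P (fU i v))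
    (R : ∀ b v, P (fR b v)) (not : ∀ φ, P φ → P (.not φ)) (and : ∀ φ ψ, P φ → P ψ → P (.and φ ψ))
    (or : ∀ φ ψ, P φ → P ψ → P (.or φ ψ)) (ex : ∀ v φ, P φ → P (.ex v φ))
    (all : ∀ v φ, P φ → P (.all v φ)) (φ : Fml (sg m d)) : P φ := by
  induction φ with
  | eq i j => exact eq i j
  | rel r v =>
    cases r with
    | inl i => exact U i v
    | inr b => exact R b v
  | not φ h => exact not φ h
  | and φ ψ h1 h2 => exact and φ ψ h1 h2
  | or φ ψ h1 h2 => exact or φ ψ h1 h2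
  | ex v φ h => exact ex v φ h
  | all v φ h => exact all v φ h

end SatEl

/-- Shifting with total shift zero is an automorphism. -/
theorem auto {m d : ℕ} (π : Gam m → Gam m) (χ : Fml (sg m d)) (hχ : UsesVars (d + 1) χ)
    (t : Fin d → Gam m) (ht : ∑ l, t l = 0) (f f' : ℕ → El m d)
    (h : ∀ i < d + 1, f' i = (f i).sh t) :
    SE π f χ ↔ SE π f' χ := by
  induction χ using sg_ind generalizing f f' with
  | eq i j =>
    rw [SE_eq, SE_eq]
    rw [h i (hχ i (by simp [Fml.vars])), h j (hχ j (by simp [Fml.vars])), El.sh_inj]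
  | U i v =>
    rw [SE_U, SE_U, h _ (fU_vars hχ _), El.sh_bit]
  | R b v =>
    have hv := fR_vars hχ
    rw [SE_R, SE_R]
    simp only [h _ (hv _), El.sh_L, El.sh_Z]
    constructor
    · rintro ⟨a, y, h1, h2, h3⟩
      refine ⟨a, y + t, h1, ?_, ?_⟩
      · simpa using h2
      · simpa [Finset.sum_add_distrib, ht] using h3
    · rintro ⟨a, y, h1, h2, h3⟩
      refine ⟨a, y - t, h1, ?_, ?_⟩
      · simpa using h2
      · simpa [Finset.sum_sub_distrib, ht] using h3
  | not φ ih =>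
    rw [SE_not, SE_not, ih hχ f f' h]
  | and φ ψ ih1 ih2 =>
    rw [SE_and, SE_and, ih1 (fun i hi => hχ i (by simp [Fml.vars, hi])) f f' h,
      ih2 (fun i hi => hχ i (by simp [Fml.vars, hi])) f f' h]
  | or φ ψ ih1 ih2 =>
    rw [SE_or, SE_or, ih1 (fun i hi => hχ i (by simp [Fml.vars, hi])) f f' h,
      ih2 (fun i hi => hχ i (by simp [Fml.vars, hi])) f f' h]
  | ex v φ ih =>
    have hφ : UsesVars (d + 1) φ := fun i hi => hχ i (by simp [Fml.vars, hi])
    rw [SE_ex, SE_ex]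
    constructor
    · rintro ⟨a, ha⟩
      exact ⟨El.sh t a, (ih hφ _ _ (update_rel fun i hi _ => h i hi)).1 ha⟩
    · rintro ⟨a, ha⟩
      refine ⟨El.sh (-t) a, (ih hφ _ _ (update_rel fun i hi _ => h i hi)).2 ?_⟩
      rwa [El.sh_neg']
  | all v φ ih =>
    have hφ : UsesVars (d + 1) φ := fun i hi => hχ i (by simp [Fml.vars, hi])
    rw [SE_all, SE_all]
    constructor
    · intro H a
      have := (ih hφ _ _ (update_rel fun i hi _ => h i hi)).1 (H (El.sh (-t) a))
      rwa [El.sh_neg'] at this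
    · intro H a
      exact (ih hφ _ _ (update_rel fun i hi _ => h i hi)).2 (H (El.sh t a))

/-- `ρ` lists variables carrying all sorts, with values `x`. -/
def Full {m d : ℕ} (f : ℕ → El m d) (ρ : Fin d → ℕ) (x : Fin d → Gam m) : Prop :=
  ∀ l, ρ l < d + 1 ∧ f (ρ l) = .Z l (x l)

/-- some variable is in the second label sort -/
def HasE {m d : ℕ} (f : ℕ → El m d) : Prop := ∃ w < d + 1, (f w).IsE

/-- the condition on the shift -/
def Cond {m d : ℕ} (π : Gam m → Gam m) (f : ℕ → El m d) (t : Fin d → Gam m) : Prop :=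
  (HasE f → ∀ ρ x, Full f ρ x → π (∑ l, x l) = ∑ l, x l + ∑ l, t l) ∧
  (¬ HasE f → ∑ l, t l = 0)

/-- the back-and-forth relation -/
def Rl {m d : ℕ} (π : Gam m → Gam m) (f f' : ℕ → El m d) (t : Fin d → Gam m) : Prop :=
  (∀ i < d + 1, f' i = (f i).sh t) ∧ Cond π f t

theorem Full.sh {m d : ℕ} {f f' : ℕ → El m d} {t : Fin d → Gam m} {ρ : Fin d → ℕ}
    {x : Fin d → Gam m} (h : ∀ i < d + 1, f' i = (f i).sh t) (hF : Full f ρ x) :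
    Full f' ρ (x + t) := by
  intro l
  refine ⟨(hF l).1, ?_⟩
  rw [h _ (hF l).1, (hF l).2]
  rfl

theorem inv_sh {m d : ℕ} {f f' : ℕ → El m d} {t : Fin d → Gam m}
    (h : ∀ i < d + 1, f' i = (f i).sh t) : ∀ i < d + 1, f i = (f' i).sh (-t) := by
  intro i hi
  rw [h i hi, El.sh_neg]

theorem HasE_iff {m d : ℕ} {f f' : ℕ → El m d} {t : Fin d → Gam m}
    (h : ∀ i < d + 1, f' i = (f i).sh t) : HasE f' ↔ HasE f := by
  unfold HasE
  refine exists_congr fun w => and_congr_right fun hw => ?_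
  rw [h w hw, El.sh_IsE]

theorem Rl.symm {m d : ℕ} {π : Gam m → Gam m} (hπ : ∀ s, π (π s) = s) {f f' : ℕ → El m d}
    {t : Fin d → Gam m} (h : Rl π f f' t) : Rl π f' f (-t) := by
  have h' := inv_sh h.1
  refine ⟨h', ?_, ?_⟩
  · intro hE ρ x hF
    have h2 := h.2.1 ((HasE_iff h.1).1 hE) ρ _ (hF.sh h')
    simp only [Pi.add_apply, Pi.neg_apply, Finset.sum_add_distrib, Finset.sum_neg_distrib] at h2 ⊢
    rw [neg_add_cancel_right] at h2
    have h3 := congrArg π h2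
    rw [hπ] at h3
    exact h3.symm
  · intro hE
    have := h.2.2 (fun hE' => hE ((HasE_iff h.1).2 hE'))
    simp [this]

/-- If all sorts occur together with one further variable, all variables are accounted for. -/
theorem cover {m d : ℕ} {f : ℕ → El m d} {ρ : Fin d → ℕ} {x : Fin d → Gam m} (hF : Full f ρ x)
    {w : ℕ} (hw : w < d + 1) (hwρ : ∀ l, ρ l ≠ w) {i : ℕ} (hi : i < d + 1) (hiw : i ≠ w) :
    ∃ l, i = ρ l := by
  let g : Option (Fin d) → Fin (d + 1) := fun o => match o with
    | none => ⟨w, hw⟩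
    | some l => ⟨ρ l, (hF l).1⟩
  have hg : Function.Injective g := by
    intro a b hab
    rcases a with _ | a <;> rcases b with _ | b
    · rfl
    · simp only [g, Fin.mk.injEq] at hab
      exact absurd hab.symm (hwρ b)
    · simp only [g, Fin.mk.injEq] at hab
      exact absurd hab (hwρ a)
    · simp only [g, Fin.mk.injEq] at hab
      have h1 := (hF a).2
      rw [hab, (hF b).2] at h1
      simp only [El.Z.injEq] at h1
      rw [h1.1]
  have hs : Function.Surjective g :=
    ((Fintype.bijective_iff_injective_and_card g).2 ⟨hg, by simp⟩).2
  obtain ⟨o, ho⟩ := hs ⟨i, hi⟩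
  rcases o with _ | l
  · simp only [g, Fin.mk.injEq] at ho
    exact absurd ho.symm hiw
  · simp only [g, Fin.mk.injEq] at ho
    exact ⟨l, ho.symm⟩

theorem full_unique {m d : ℕ} {f : ℕ → El m d} {ρ ρ' : Fin d → ℕ} {x x' : Fin d → Gam m}
    (hE : HasE f) (hF : Full f ρ x) (hF' : Full f ρ' x') : x = x' := by
  obtain ⟨w, hw, hwE⟩ := hE
  have key : ∀ {ρ : Fin d → ℕ} {x : Fin d → Gam m}, Full f ρ x → ∀ l, ρ l ≠ w := by
    intro ρ x hF l hl
    rw [← hl, (hF l).2] at hwE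
    exact hwE
  funext l
  obtain ⟨l', hl'⟩ := cover hF hw (key hF) (hF' l).1 (key hF' l)
  have h1 := (hF' l).2
  rw [hl', (hF l').2] at h1
  simp only [El.Z.injEq] at h1
  obtain ⟨rfl, h1⟩ := h1
  exact h1

theorem sum_update {m d : ℕ} (t : Fin d → Gam m) (l0 : Fin d) (s : Gam m) :
    ∃ y, ∑ l, Function.update t l0 y l = s := by
  refine ⟨s - ∑ l ∈ Finset.univ \ {l0}, t l, ?_⟩
  rw [Finset.sum_update_of_mem (Finset.mem_univ _)]
  simp

theorem exists_cond {m d : ℕ} (π : Gam m → Gam m) (f : ℕ → El m d) (t : Fin d → Gam m)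
    (l0 : Fin d) : ∃ y, Cond π f (Function.update t l0 y) := by
  by_cases hE : HasE f
  · by_cases hF : ∃ ρ x, Full f ρ x
    · obtain ⟨ρ, x, hF⟩ := hF
      obtain ⟨y, hy⟩ := sum_update t l0 (π (∑ l, x l) - ∑ l, x l)
      refine ⟨y, fun _ ρ' x' hF' => ?_, fun h => absurd hE h⟩
      rw [← full_unique hE hF hF', hy]
      simp
    · exact ⟨0, fun _ ρ x h => absurd ⟨ρ, x, h⟩ hF, fun h => absurd hE h⟩
  · obtain ⟨y, hy⟩ := sum_update t l0 0
    exact ⟨y, fun h => absurd h hE, fun _ => hy⟩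

/-- Forth step when some sort is absent from the other variables. -/
theorem forth {m d : ℕ} {π : Gam m → Gam m} {f f' : ℕ → El m d} {t : Fin d → Gam m}
    (h : ∀ i < d + 1, f' i = (f i).sh t) (v : ℕ) (l0 : Fin d)
    (hl : ∀ i < d + 1, i ≠ v → ∀ y, f i ≠ .Z l0 y) (a : El m d) :
    ∃ a' t', Rl π (Function.update f v a) (Function.update f' v a') t' := by
  obtain ⟨y, hy⟩ := exists_cond π (Function.update f v a) t l0
  refine ⟨a.sh (Function.update t l0 y), Function.update t l0 y, update_rel ?_, hy⟩
  intro i hi hiv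
  rw [h i hi]
  have := hl i hi hiv
  cases hfi : f i with
  | L b c => rfl
  | Z l z =>
    have hne : l ≠ l0 := by
      rintro rfl
      exact this z hfi
    simp [El.sh, Function.update_of_ne hne]

/-- The bits recorded for the pigeonhole argument. -/
def Ex {m d : ℕ} (q : ℕ × Fml (sg m d)) (ρ : Fin d → ℕ) (p : Bool) (s : Gam m) : Prop :=
  ∃ (f : ℕ → El m d) (x : Fin d → Gam m), Full f ρ x ∧ ∑ l, x l = s ∧
    ∃ a : El m d, (a.IsE ↔ p = true) ∧ SE id (Function.update f q.1 a) q.2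

theorem Ex_iff {m d : ℕ} {v : ℕ} {χ : Fml (sg m d)} (hχ : UsesVars (d + 1) χ) (hv : v < d + 1)
    {ρ : Fin d → ℕ} (hρ : ∀ l, ρ l ≠ v) (p : Bool) {f : ℕ → El m d} {x : Fin d → Gam m}
    (hF : Full f ρ x) : Ex (v, χ) ρ p (∑ l, x l) ↔
      ∃ a : El m d, (a.IsE ↔ p = true) ∧ SE id (Function.update f v a) χ := by
  constructor
  · rintro ⟨f0, x0, hF0, hs, a, ha, hS⟩
    refine ⟨a.sh (x - x0), by rwa [El.sh_IsE], ?_⟩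
    refine (auto id χ hχ (x - x0) (by simp [Finset.sum_sub_distrib, hs]) _ _
      (update_rel ?_)).1 hS
    intro i hi hiv
    obtain ⟨l, rfl⟩ := cover hF hv hρ hi hiv
    rw [(hF l).2, (hF0 l).2]
    simp [El.sh]
  · rintro ⟨a, ha, hS⟩
    exact ⟨f, x, hF, rfl, a, ha, hS⟩

theorem full_update {m d : ℕ} {f : ℕ → El m d} {ρ : Fin d → ℕ} {x : Fin d → Gam m} {v : ℕ}
    (hρ : ∀ l, ρ l ≠ v) (a : El m d) : Full (Function.update f v a) ρ x ↔ Full f ρ x := by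
  unfold Full
  refine forall_congr' fun l => ?_
  rw [Function.update_of_ne (hρ l)]

/-- The quantifier step of the main lemma. -/
theorem ex_step {m d : ℕ} (hd : 0 < d) {π : Gam m → Gam m} (hπ : ∀ s, π (π s) = s)
    {v : ℕ} {χ : Fml (sg m d)} (hχ : UsesVars (d + 1) χ) (hv : v < d + 1)
    (hbits : ∀ ρ : Fin d → ℕ, (∀ l, ρ l < d + 1) → ∀ p s, Ex (v, χ) ρ p (π s) ↔ Ex (v, χ) ρ p s)
    (ih : ∀ f f' t, Rl π f f' t → (SE π f χ ↔ SE id f' χ))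
    (f f' : ℕ → El m d) (t : Fin d → Gam m) (h : Rl π f f' t) :
    (∃ a, SE π (Function.update f v a) χ) ↔ ∃ a, SE id (Function.update f' v a) χ := by
  by_cases hc : ∃ l0 : Fin d, ∀ i < d + 1, i ≠ v → ∀ y, f i ≠ .Z l0 y
  · obtain ⟨l0, hl⟩ := hc
    constructor
    · rintro ⟨a, ha⟩
      obtain ⟨a', t', h'⟩ := forth (π := π) h.1 v l0 hl a
      exact ⟨a', (ih _ _ _ h').1 ha⟩
    · rintro ⟨a, ha⟩
      have hl' : ∀ i < d + 1, i ≠ v → ∀ y, f' i ≠ .Z l0 y := by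
        intro i hi hiv y
        rw [h.1 i hi, Ne, El.sh_Z]
        exact hl i hi hiv _
      obtain ⟨a', t', h'⟩ := forth (π := π) (inv_sh h.1) v l0 hl' a
      exact ⟨a', (ih _ _ _ (h'.symm hπ)).2 ha⟩
  · push Not at hc
    choose ρ hρ1 hρ2 x hx using hc
    have hF : Full f ρ x := fun l => ⟨hρ1 l, hx l⟩
    have hF' := hF.sh h.1
    have hb := hbits ρ hρ1
    have hEu : ∀ a : El m d, HasE (Function.update f v a) ↔ a.IsE := by
      intro a
      constructor
      · rintro ⟨w, hw, hwE⟩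
        by_cases hwv : w = v
        · subst hwv; simpa using hwE
        · obtain ⟨l, rfl⟩ := cover hF hv hρ2 hw hwv
          rw [Function.update_of_ne hwv, hx l] at hwE
          exact hwE.elim
      · intro ha
        exact ⟨v, hv, by simpa using ha⟩
    have hn : (∃ a : El m d, (a.IsE ↔ false = true) ∧ SE π (Function.update f v a) χ) ↔
        Ex (v, χ) ρ false (∑ l, x l) := by
      rw [Ex_iff hχ hv hρ2 false hF]
      refine exists_congr fun a => and_congr_right fun ha => ?_
      refine ih _ _ 0 ⟨fun i _ => (El.sh_zero _).symm, fun hE => ?_, fun _ => by simp⟩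
      rw [hEu, ha] at hE
      simp at hE
    have he : (∃ a : El m d, (a.IsE ↔ true = true) ∧ SE π (Function.update f v a) χ) ↔
        Ex (v, χ) ρ true (∑ l, x l) := by
      obtain ⟨y, hy⟩ := sum_update (0 : Fin d → Gam m) ⟨0, hd⟩ (π (∑ l, x l) - ∑ l, x l)
      set t1 := Function.update (0 : Fin d → Gam m) ⟨0, hd⟩ y with ht1
      have hF1 : Full (fun i => (f i).sh t1) ρ (x + t1) := hF.sh fun i _ => rfl
      have hsum : ∑ l, (x + t1) l = π (∑ l, x l) := by
        simp [Finset.sum_add_distrib, hy]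
      rw [← hb, ← hsum, Ex_iff hχ hv hρ2 true hF1]
      refine exists_congr fun a => and_congr_right fun ha => ?_
      have hE : a.IsE := by simpa using ha
      have hash : a.sh t1 = a := by
        cases a with
        | L b c => rfl
        | Z => exact hE.elim
      refine ih _ _ t1 ⟨?_, fun _ ρ' x' hF2 => ?_, fun hE' => absurd ((hEu a).2 hE) hE'⟩
      · have := update_rel (f := f) (f' := fun i => (f i).sh t1) (t := t1) (v := v) (a := a)
          (fun i _ _ => rfl)
        rwa [hash] at this
      · rw [← full_unique ((hEu a).2 hE) ((full_update hρ2 a).2 hF) hF2, hy]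
        simp
    have split : ∀ (π' : Gam m → Gam m) (f : ℕ → El m d),
        (∃ a, SE π' (Function.update f v a) χ) ↔
        (∃ a : El m d, (a.IsE ↔ false = true) ∧ SE π' (Function.update f v a) χ) ∨
        (∃ a : El m d, (a.IsE ↔ true = true) ∧ SE π' (Function.update f v a) χ) := by
      intro π' f
      constructor
      · rintro ⟨a, ha⟩
        by_cases hE : a.IsE
        · exact Or.inr ⟨a, by simpa using hE, ha⟩
        · exact Or.inl ⟨a, by simpa using hE, ha⟩
      · rintro (⟨a, -, ha⟩ | ⟨a, -, ha⟩)
        · exact ⟨a, ha⟩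
        · exact ⟨a, ha⟩
    rw [split, split id, hn, he, ← Ex_iff hχ hv hρ2 false hF', ← Ex_iff hχ hv hρ2 true hF']
    have hs : ∑ l, (x + t) l = ∑ l, x l ∨ ∑ l, (x + t) l = π (∑ l, x l) := by
      by_cases hE : HasE f
      · right
        rw [h.2.1 hE ρ x hF]
        simp [Finset.sum_add_distrib]
      · left
        simp [Finset.sum_add_distrib, h.2.2 hE]
    rcases hs with hs | hs
    · rw [hs]
    · rw [hs, hb, hb]

/-- Main lemma. -/
theorem main_lemma {m d : ℕ} (hd : 0 < d) {π : Gam m → Gam m} (hπ : ∀ s, π (π s) = s)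
    (χ : Fml (sg m d)) (hχ : UsesVars (d + 1) χ)
    (hbits : ∀ q ∈ qs χ, ∀ ρ : Fin d → ℕ, (∀ l, ρ l < d + 1) →
      ∀ p s, Ex q ρ p (π s) ↔ Ex q ρ p s)
    (f f' : ℕ → El m d) (t : Fin d → Gam m) (h : Rl π f f' t) : SE π f χ ↔ SE id f' χ := by
  induction χ using sg_ind generalizing f f' t with
  | eq i j =>
    rw [SE_eq, SE_eq, h.1 i (hχ i (by simp [Fml.vars])), h.1 j (hχ j (by simp [Fml.vars])),
      El.sh_inj]
  | U i v =>
    rw [SE_U, SE_U, h.1 _ (fU_vars hχ _), El.sh_bit]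
  | R b v =>
    have hv := fR_vars hχ
    have key : ∀ (a : Lab m) (y : Fin d → Gam m), f (v 0) = .L b a →
        (∀ l : Fin d, f (v l.succ) = .Z l (y l)) →
        (Hld π b (∑ l, y l) a ↔ Hld id b (∑ l, (y + t) l) a) := by
      intro a y h0 h1
      have hF : Full f (fun l => v l.succ) y := fun l => ⟨hv _, h1 l⟩
      have hne : ∀ l : Fin d, v l.succ ≠ v 0 := by
        intro l hl
        have := h1 l
        rw [hl, h0] at this
        simp at this
      simp only [Pi.add_apply, Finset.sum_add_distrib]
      cases b with
      | false =>
        have hE : HasE f := ⟨v 0, hv 0, by rw [h0]; rfl⟩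
        rw [← h.2.1 hE _ _ hF]
        simp [Hld]
      | true =>
        have hE : ¬ HasE f := by
          rintro ⟨w, hw, hwE⟩
          by_cases hw0 : w = v 0
          · subst hw0
            rw [h0] at hwE
            simp [El.IsE] at hwE
          · obtain ⟨l, rfl⟩ := cover hF (hv 0) hne hw hw0
            rw [h1 l] at hwE
            exact hwE
        rw [h.2.2 hE]
        simp [Hld]
    rw [SE_R, SE_R]
    simp only [h.1 _ (hv _), El.sh_L, El.sh_Z]
    constructor
    · rintro ⟨a, y, h1, h2, h3⟩
      exact ⟨a, y + t, h1, by simpa using h2, (key a y h1 h2).1 h3⟩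
    · rintro ⟨a, y, h1, h2, h3⟩
      refine ⟨a, y - t, h1, by simpa using h2, (key a (y - t) h1 (by simpa using h2)).2 ?_⟩
      simpa using h3
  | not φ ih =>
    rw [SE_not, SE_not, ih hχ hbits f f' t h]
  | and φ ψ ih1 ih2 =>
    rw [SE_and, SE_and, ih1 (fun i hi => hχ i (by simp [Fml.vars, hi]))
      (fun q hq => hbits q (by simp [qs, hq])) f f' t h,
      ih2 (fun i hi => hχ i (by simp [Fml.vars, hi]))
      (fun q hq => hbits q (by simp [qs, hq])) f f' t h]
  | or φ ψ ih1 ih2 =>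
    rw [SE_or, SE_or, ih1 (fun i hi => hχ i (by simp [Fml.vars, hi]))
      (fun q hq => hbits q (by simp [qs, hq])) f f' t h,
      ih2 (fun i hi => hχ i (by simp [Fml.vars, hi]))
      (fun q hq => hbits q (by simp [qs, hq])) f f' t h]
  | ex v φ ih =>
    have hφ : UsesVars (d + 1) φ := fun i hi => hχ i (by simp [Fml.vars, hi])
    rw [SE_ex, SE_ex]
    exact ex_step hd hπ hφ (hχ v (by simp [Fml.vars])) (hbits (v, φ) (by simp [qs]))
      (ih hφ fun q hq => hbits q (by simp [qs, hq])) f f' t h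
  | all v φ ih =>
    have hφ : UsesVars (d + 1) φ := fun i hi => hχ i (by simp [Fml.vars, hi])
    rw [SE_all, SE_all, ← not_iff_not]
    push Not
    exact ex_step (χ := .not φ) hd hπ hφ (hχ v (by simp [Fml.vars]))
      (hbits (v, .not φ) (by simp [qs]))
      (fun f f' t h => not_congr (ih hφ (fun q hq => hbits q (by simp [qs, hq])) f f' t h)) f f' t h

open Classical in
/-- Exponential lower bound. -/
theorem lower_s1 {m d : ℕ} (hd : 0 < d) (χ : Fml (sg m d)) (hχ : UsesVars (d + 1) χ)
    (heq : ∀ M : Struct (sg m d), Finite M.carrier → Nonempty M.carrier →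
      (SatS M (phi m d) ↔ SatS M χ)) :
    2 ^ m ≤ χ.size * (2 * (d + 1) ^ d) := by
  by_contra hlt
  push Not at hlt
  let I := Fin (qs χ).length × (Fin d → Fin (d + 1)) × Bool
  let F : Gam m → I → Bool := fun s i =>
    decide (Ex ((qs χ).get i.1) (fun l => (i.2.1 l).val) i.2.2 s)
  have hcard : Fintype.card (I → Bool) < Fintype.card (Gam m) := by
    have h1 : Fintype.card I = (qs χ).length * ((d + 1) ^ d * 2) := by
      simp [I]
    rw [Fintype.card_fun, Fintype.card_fun, h1]
    simp only [Fintype.card_bool, ZMod.card, Fintype.card_fun, Fintype.card_fin]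
    apply Nat.pow_lt_pow_right (by norm_num)
    refine lt_of_le_of_lt ?_ hlt
    rw [mul_comm ((d + 1) ^ d) 2]
    exact Nat.mul_le_mul_right _ (qs_length χ)
  obtain ⟨g, g', hne, hF⟩ := Fintype.exists_ne_map_eq_of_card_lt F hcard
  have hgg : ∀ q ∈ qs χ, ∀ ρ : Fin d → ℕ, (∀ l, ρ l < d + 1) → ∀ p, Ex q ρ p g ↔ Ex q ρ p g' := by
    intro q hq ρ hρ p
    obtain ⟨n, hn⟩ := List.get_of_mem hq
    have := congrFun hF (n, fun l => ⟨ρ l, hρ l⟩, p)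
    simp only [F, decide_eq_decide, hn] at this
    exact this
  let π : Gam m → Gam m := fun s => Equiv.swap g g' s
  have hπ : ∀ s, π (π s) = s := fun s => Equiv.swap_apply_self g g' s
  have hbits : ∀ q ∈ qs χ, ∀ ρ : Fin d → ℕ, (∀ l, ρ l < d + 1) →
      ∀ p s, Ex q ρ p (π s) ↔ Ex q ρ p s := by
    intro q hq ρ hρ p s
    have h := hgg q hq ρ hρ p
    by_cases h1 : s = g
    · subst h1
      simp only [π, Equiv.swap_apply_left]
      exact h.symm
    · by_cases h2 : s = g'
      · subst h2
        simp only [π, Equiv.swap_apply_right]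
        exact h
      · simp only [π, Equiv.swap_apply_of_ne_of_ne h1 h2]
  have hfin : ∀ π, Finite (St m d π).carrier := fun _ => inferInstanceAs (Finite (El m d))
  have hnon : ∀ π, Nonempty (St m d π).carrier := fun _ => inferInstanceAs (Nonempty (El m d))
  have hA : Prp (St m d π) := by
    rw [Prp_St hd]
    obtain ⟨a, ha⟩ := Function.ne_iff.1 hne
    have two : ∀ x y : ZMod 2, x ≠ y → (x = 1 ∧ y ≠ 1) ∨ (y = 1 ∧ x ≠ 1) := by decide
    rcases two _ _ ha with h | h
    · exact ⟨g, a, h.1, by simpa [π] using h.2⟩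
    · exact ⟨g', a, h.1, by simpa [π] using h.2⟩
  have hB : ¬ Prp (St m d id) := by
    rw [Prp_St hd]
    rintro ⟨s, a, h1, h2⟩
    exact h2 h1
  have hAs : SatS (St m d π) χ :=
    (heq _ (hfin _) (hnon _)).1 fun f => (phi_sat _ f).2 hA
  have hBs : SatS (St m d id) χ := by
    intro (f : ℕ → El m d)
    obtain ⟨y, hy⟩ := exists_cond π f 0 ⟨0, hd⟩
    have hR : Rl π f (fun i => (f i).sh _) _ := ⟨fun i _ => rfl, hy⟩
    exact (main_lemma hd hπ χ hχ hbits _ _ _ (hR.symm hπ)).1 (hAs _)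
  have := (heq _ (hfin _) (hnon _)).2 hBs
  obtain ⟨c⟩ := hnon id
  exact hB ((phi_sat _ _).1 (this fun _ => c))

/-- Theorem 2 of the paper. For every integer `k ≥ 3` there exists a
real `ε > 0` such that for every `n` there are a finite relational signature `σ` and a
sentence `φ` of `L^{k+1}` over `σ` with `|φ| ≥ n` which is logically equivalent (over
all finite nonempty `σ`-structures) to some sentence of `L^k`, yet every such
equivalent `L^k`-sentence `ψ` satisfies `|ψ| ≥ 2 ^ (ε * |φ|)`. -/
theorem statement_1 (k : ℕ) (hk : 3 ≤ k) :
    ∃ ε : ℝ, 0 < ε ∧ ∀ n : ℕ,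
      ∃ (σ : Signature) (φ : Fml σ),
        UsesVars (k + 1) φ ∧ IsSentence φ ∧ n ≤ φ.size ∧
        (∃ ψ : Fml σ, UsesVars k ψ ∧ IsSentence ψ ∧
          ∀ M : Struct σ, Finite M.carrier → Nonempty M.carrier →
            (SatS M φ ↔ SatS M ψ)) ∧
        ∀ ψ : Fml σ, UsesVars k ψ → IsSentence ψ →
          (∀ M : Struct σ, Finite M.carrier → Nonempty M.carrier →
            (SatS M φ ↔ SatS M ψ)) →
          (2 : ℝ) ^ (ε * φ.size) ≤ (ψ.size : ℝ) := by
  obtain ⟨d, rfl⟩ : ∃ d, k = d + 1 := ⟨k - 1, by omega⟩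
  have hd : 0 < d := by omega
  refine ⟨1 / 30, by norm_num, fun n => ?_⟩
  set N := 2 * (d + 1) ^ d with hN
  set r := n + 4 * d + 13 + N with hr
  refine ⟨sg (2 * r) d, phi (2 * r) d, phi_vars _ _, phi_sentence _ _, ?_, ?_, ?_⟩
  · rw [phi_size]; omega
  · refine ⟨psi (2 * r) d, psi_vars _ _, psi_sentence _ _, fun M _ _ => ?_⟩
    exact forall_congr' fun f => (phi_sat M f).trans (psi_sat M f).symm
  · intro ψ hψ _ heq
    have h1 := lower_s1 hd ψ hψ heq
    rw [← hN] at h1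
    have h2 : N ≤ 2 ^ r := by
      calc N ≤ 2 ^ N := Nat.lt_two_pow_self.le
        _ ≤ 2 ^ r := Nat.pow_le_pow_right (by norm_num) (by omega)
    have h3 : 2 ^ r ≤ ψ.size := by
      have h4 : 2 ^ r * 2 ^ r ≤ ψ.size * 2 ^ r := by
        calc 2 ^ r * 2 ^ r = 2 ^ (2 * r) := by rw [two_mul]; exact (pow_add 2 r r).symm
          _ ≤ ψ.size * N := h1
          _ ≤ ψ.size * 2 ^ r := Nat.mul_le_mul_left _ h2
      exact Nat.le_of_mul_le_mul_right h4 (by positivity)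
    have h5 : (1 / 30 : ℝ) * ((phi (2 * r) d).size : ℝ) ≤ (r : ℝ) := by
      have : (phi (2 * r) d).size ≤ 30 * r := by rw [phi_size]; omega
      have : ((phi (2 * r) d).size : ℝ) ≤ 30 * r := by exact_mod_cast this
      linarith
    calc (2 : ℝ) ^ ((1 / 30 : ℝ) * ((phi (2 * r) d).size : ℝ)) ≤ (2 : ℝ) ^ (r : ℝ) :=
          Real.rpow_le_rpow_of_exponent_le (by norm_num) h5
      _ = (2 : ℝ) ^ r := Real.rpow_natCast _ _
      _ ≤ (ψ.size : ℝ) := by exact_mod_cast h3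

end QVT
end
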